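/- arXiv:2310.15963 — 9 statements merged into one kernel-verified Lean document; each statement's English description precedes it below -/
import Mathlib

section
/- Zero average of the contour dynamics nonlinearity (conservation of the patch area). Let α ∈ (0,2) and let h : ℝ → ℝ be 2π-periodic and twice continuously differentiable, with 1 + h(x) > 0 for all x and with D(x,y) := (1+h(x))² + (1+h(y))² − 2(1+h(x))(1+h(y))·cos(x−y) > 0 whenever x − y ∉ 2πℤ. Define F(x,y) := { cos(x−y)·[(1+h(x))·h'(y) − (1+h(y))·h'(x)] + sin(x−y)·[(1+h(x))·(1+h(y)) + h'(x)·h'(y)] } · D(x,y)^{−α/2}. Then F is Lebesgue integrable on [−π,π] × [−π,π] and ∫_{−π}^{π} ∫_{−π}^{π} F(x,y) dy dx = 0. -/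
open Real MeasureTheory

/-- Denominator `D(x,y) := (1+h(x))² + (1+h(y))² − 2(1+h(x))(1+h(y))·cos(x−y)`. -/
noncomputable def Dden (h : ℝ → ℝ) (x y : ℝ) : ℝ :=
  (1 + h x) ^ 2 + (1 + h y) ^ 2 - 2 * (1 + h x) * (1 + h y) * Real.cos (x - y)

/-- The contour dynamics nonlinearity
`F(x,y) := {cos(x−y)[(1+h(x))h'(y) − (1+h(y))h'(x)]
           + sin(x−y)[(1+h(x))(1+h(y)) + h'(x)h'(y)]}·D(x,y)^{−α/2}`. -/
noncomputable def Fcde (α : ℝ) (h : ℝ → ℝ) (x y : ℝ) : ℝ :=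
  (Real.cos (x - y) * ((1 + h x) * deriv h y - (1 + h y) * deriv h x)
    + Real.sin (x - y) * ((1 + h x) * (1 + h y) + deriv h x * deriv h y))
  * Dden h x y ^ (-(α / 2))

open Function in
theorem Function.Periodic.deriv_real {f : ℝ → ℝ} {c : ℝ} (hf : Periodic f c) :
    Periodic (deriv f) c := fun x => by
  rw [← deriv_comp_add_const, show (fun x => f (x + c)) = f from funext hf]

open Function in
theorem Function.Periodic.exists_abs_le {f : ℝ → ℝ} {c : ℝ} (hf : Periodic f c) (hc : c ≠ 0)
    (hcont : Continuous f) : ∃ K, ∀ x, |f x| ≤ K := by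
  obtain ⟨K, hK⟩ := (hf.isBounded_of_continuous hc hcont).exists_norm_le
  exact ⟨K, fun x => hK _ ⟨x, rfl⟩⟩

theorem abs_sub_le_of_abs_deriv_le {f : ℝ → ℝ} {K : ℝ} (hf : Differentiable ℝ f)
    (hK : ∀ x, |deriv f x| ≤ K) (x y : ℝ) : |f x - f y| ≤ K * |x - y| :=
  Convex.norm_image_sub_le_of_norm_deriv_le (s := Set.univ) (fun z _ => hf z) (fun z _ => hK z)
    convex_univ trivial trivial

/-- The trigonometric factor of the contour dynamics nonlinearity for the radius `r = 1 + h`. -/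
noncomputable def contourNumerator (r : ℝ → ℝ) (x y : ℝ) : ℝ :=
  Real.cos (x - y) * (r x * deriv r y - r y * deriv r x)
    + Real.sin (x - y) * (r x * r y + deriv r x * deriv r y)

theorem abs_contourNumerator_le_dist {r : ℝ → ℝ} {K : ℝ} (hr : ContDiff ℝ 2 r)
    (h0 : ∀ x, |r x| ≤ K) (h1 : ∀ x, |deriv r x| ≤ K) (h2 : ∀ x, |deriv (deriv r) x| ≤ K)
    (x y : ℝ) : |contourNumerator r x y| ≤ 4 * K ^ 2 * |x - y| := by
  have hK : 0 ≤ K := (abs_nonneg _).trans (h0 0)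
  have hr' : ContDiff ℝ 1 (deriv r) := hr.deriv'
  have l0 := abs_sub_le_of_abs_deriv_le (hr.differentiable (by norm_num)) h1 x y
  have l1 := abs_sub_le_of_abs_deriv_le (hr'.differentiable (by norm_num)) h2 y x
  rw [abs_sub_comm y x] at l1
  have e : r x * deriv r y - r y * deriv r x
      = r x * (deriv r y - deriv r x) + (r x - r y) * deriv r x := by ring
  have hwronskian : |r x * deriv r y - r y * deriv r x| ≤ 2 * K ^ 2 * |x - y| := by
    rw [e]
    calc _ ≤ |r x| * |deriv r y - deriv r x| + |r x - r y| * |deriv r x| := by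
            simpa only [abs_mul] using abs_add_le (r x * (deriv r y - deriv r x)) ((r x - r y) * deriv r x)
      _ ≤ K * (K * |x - y|) + K * |x - y| * K := by
            gcongr
            exacts [h0 x, h1 x]
      _ = _ := by ring
  have hsum : |r x * r y + deriv r x * deriv r y| ≤ 2 * K ^ 2 := by
    calc _ ≤ |r x| * |r y| + |deriv r x| * |deriv r y| := by
            simpa only [abs_mul] using abs_add_le (r x * r y) (deriv r x * deriv r y)
      _ ≤ K * K + K * K := by
            gcongr
            exacts [h0 x, h0 y, h1 x, h1 y]
      _ = _ := by ring
  calc |contourNumerator r x y|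
      ≤ |cos (x - y)| * |r x * deriv r y - r y * deriv r x|
        + |sin (x - y)| * |r x * r y + deriv r x * deriv r y| := by
          simp only [← abs_mul]
          exact abs_add_le _ _
    _ ≤ 1 * (2 * K ^ 2 * |x - y|) + |x - y| * (2 * K ^ 2) := by
          exact add_le_add (mul_le_mul (abs_cos_le_one _) hwronskian (abs_nonneg _) one_pos.le)
            (mul_le_mul abs_sin_le_abs hsum (abs_nonneg _) (abs_nonneg _))
    _ = _ := by ring

theorem contourNumerator_add_int_mul {r : ℝ → ℝ} (hper : Function.Periodic r (2 * π)) (x y : ℝ)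
    (k : ℤ) : contourNumerator r x (y + k * (2 * π)) = contourNumerator r x y := by
  simp only [contourNumerator, hper.int_mul k y, hper.deriv_real.int_mul k y, ← sub_sub,
    cos_sub_int_mul_two_pi, sin_sub_int_mul_two_pi]

theorem abs_contourNumerator_le_sin {r : ℝ → ℝ} (hr : ContDiff ℝ 2 r)
    (hper : Function.Periodic r (2 * π)) :
    ∃ C, 0 ≤ C ∧ ∀ x y, |contourNumerator r x y| ≤ C * |sin ((x - y) / 2)| := by
  have hr' : ContDiff ℝ 1 (deriv r) := hr.deriv'
  obtain ⟨K₀, h0⟩ := hper.exists_abs_le two_pi_pos.ne' hr.continuous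
  obtain ⟨K₁, h1⟩ := hper.deriv_real.exists_abs_le two_pi_pos.ne' hr'.continuous
  obtain ⟨K₂, h2⟩ := hper.deriv_real.deriv_real.exists_abs_le two_pi_pos.ne'
    (hr'.continuous_deriv le_rfl)
  set K := max K₀ (max K₁ K₂)
  refine ⟨4 * K ^ 2 * π, by positivity, fun x y => ?_⟩
  set k := round ((x - y) / (2 * π))
  set u := y + k * (2 * π) with hu
  have hxu : |x - u| ≤ π := by
    have hround := abs_sub_round ((x - y) / (2 * π))
    have e : x - u = ((x - y) / (2 * π) - k) * (2 * π) := by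
      rw [hu]; field_simp; ring
    rw [e, abs_mul, abs_of_pos two_pi_pos]
    nlinarith [pi_pos]
  have hsin : |sin ((x - u) / 2)| = |sin ((x - y) / 2)| := by
    rw [show (x - u) / 2 = (x - y) / 2 - k * π by rw [hu]; ring, sin_sub_int_mul_pi, abs_mul,
      abs_neg_one_zpow, one_mul]
  have hle : |x - u| ≤ π * |sin ((x - u) / 2)| := by
    have hjordan := mul_abs_le_abs_sin (x := (x - u) / 2)
      (by rw [abs_div, abs_two]; linarith)
    rw [abs_div, abs_two] at hjordan
    calc |x - u| = π * (2 / π * (|x - u| / 2)) := by field_simp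
      _ ≤ _ := by gcongr
  calc |contourNumerator r x y| = |contourNumerator r x u| := by
        rw [hu, contourNumerator_add_int_mul hper]
    _ ≤ 4 * K ^ 2 * |x - u| := abs_contourNumerator_le_dist hr
        (fun z => (h0 z).trans (le_max_left _ _))
        (fun z => (h1 z).trans ((le_max_left _ _).trans (le_max_right _ _)))
        (fun z => (h2 z).trans ((le_max_right _ _).trans (le_max_right _ _))) x u
    _ ≤ 4 * K ^ 2 * (π * |sin ((x - y) / 2)|) := by rw [← hsin]; gcongr
    _ = _ := by ring

theorem Dden_eq (h : ℝ → ℝ) (x y : ℝ) :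
    Dden h x y = (h x - h y) ^ 2 + 4 * (1 + h x) * (1 + h y) * sin ((x - y) / 2) ^ 2 := by
  have hcos : cos (x - y) = 1 - 2 * sin ((x - y) / 2) ^ 2 := by
    rw [sin_sq, show x - y = 2 * ((x - y) / 2) by ring, cos_two_mul]
    ring_nf
  rw [Dden, hcos]; ring

theorem sq_sin_le_Dden {h : ℝ → ℝ} {m : ℝ} (hm : 0 ≤ m) (hmh : ∀ x, m ≤ 1 + h x) (x y : ℝ) :
    (2 * m * |sin ((x - y) / 2)|) ^ 2 ≤ Dden h x y := by
  have hmul : m * m ≤ (1 + h x) * (1 + h y) :=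
    mul_le_mul (hmh x) (hmh y) hm (hm.trans (hmh x))
  rw [Dden_eq, mul_pow, sq_abs]
  nlinarith [mul_le_mul_of_nonneg_right hmul (sq_nonneg (sin ((x - y) / 2))),
    sq_nonneg (h x - h y)]

theorem Fcde_eq (α : ℝ) (h : ℝ → ℝ) (x y : ℝ) :
    Fcde α h x y = contourNumerator (fun z => 1 + h z) x y * Dden h x y ^ (-(α / 2)) := by
  simp only [Fcde, contourNumerator, deriv_const_add']

theorem abs_Fcde_le {α : ℝ} (hα : 0 ≤ α) {h : ℝ → ℝ}
    (hper : Function.Periodic h (2 * π)) (hreg : ContDiff ℝ 2 h) (hpos : ∀ x, 0 < 1 + h x) :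
    ∃ C, 0 ≤ C ∧ ∀ x y, |Fcde α h x y| ≤ C * |sin ((x - y) / 2)| ^ (min 0 (1 - α)) := by
  obtain ⟨C, hC, hnum⟩ := abs_contourNumerator_le_sin (r := fun z => 1 + h z)
    (contDiff_const.add hreg) (fun x => by simp only [hper x])
  have hinv : Function.Periodic (fun x => (1 + h x)⁻¹) (2 * π) := fun x => by simp only [hper x]
  obtain ⟨M, hM⟩ := hinv.exists_abs_le two_pi_pos.ne'
    ((continuous_const.add hreg.continuous).inv₀ fun x => (hpos x).ne')
  have hM' : ∀ x, (1 + h x)⁻¹ ≤ M := fun x => (le_abs_self _).trans (hM x)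
  have hMpos : 0 < M := (inv_pos.2 (hpos 0)).trans_le (hM' 0)
  have hmh : ∀ x, M⁻¹ ≤ 1 + h x := fun x => inv_le_of_inv_le₀ (hpos x) (hM' x)
  set c := 2 * M⁻¹
  have hc : 0 < c := by positivity
  refine ⟨C * c ^ (-α), by positivity, fun x y => ?_⟩
  have hDle := sq_sin_le_Dden (inv_pos.2 hMpos).le hmh x y
  have hn := hnum x y
  have hs0 := abs_nonneg (sin ((x - y) / 2))
  have hs1 := abs_sin_le_one ((x - y) / 2)
  generalize |sin ((x - y) / 2)| = s at *
  rw [Fcde_eq, abs_mul]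
  rcases hs0.eq_or_lt with hs | hs
  · rw [← hs, mul_zero] at hn
    rw [le_antisymm hn (abs_nonneg _), zero_mul]
    positivity
  · have hpow : Dden h x y ^ (-(α / 2)) ≤ c ^ (-α) * s ^ (-α) := by
      calc _ ≤ ((c * s) ^ 2) ^ (-(α / 2)) :=
            rpow_le_rpow_of_nonpos (by positivity) hDle (by linarith)
        _ = c ^ (-α) * s ^ (-α) := by
            rw [← rpow_natCast, ← rpow_mul (by positivity), ← mul_rpow hc.le hs.le]
            congr 1; push_cast; ring
    have hDnonneg : 0 ≤ Dden h x y := (sq_nonneg _).trans hDle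
    rw [abs_of_nonneg (rpow_nonneg hDnonneg _)]
    calc _ ≤ C * s * (c ^ (-α) * s ^ (-α)) := by gcongr
      _ = C * c ^ (-α) * s ^ (1 - α) := by
          rw [sub_eq_add_neg, rpow_add hs, rpow_one]; ring
      _ ≤ _ := by
          gcongr ?_ * ?_
          exact rpow_le_rpow_of_exponent_ge hs hs1 (min_le_right _ _)

theorem intervalIntegrable_abs_sin_half_rpow {β : ℝ} (hβ : -1 < β) (hβ0 : β ≤ 0) (a b : ℝ) :
    IntervalIntegrable (fun t => |sin (t / 2)| ^ β) volume a b := by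
  have hper : Function.Periodic (fun t => |sin (t / 2)| ^ β) (2 * π) := fun t => by
    simp only [show (t + 2 * π) / 2 = t / 2 + π by ring, sin_add_pi, abs_neg]
  have hhalf : IntervalIntegrable (fun t => |sin (t / 2)| ^ β) volume 0 π := by
    have hint : IntervalIntegrable (fun t : ℝ => π⁻¹ ^ β * t ^ β) volume 0 π :=
      (intervalIntegral.intervalIntegrable_rpow' hβ).const_mul _
    refine hint.mono_fun (Measurable.aestronglyMeasurable (by fun_prop)) ?_
    rw [Set.uIoc_of_le pi_pos.le]
    filter_upwards [ae_restrict_mem measurableSet_Ioc] with t ht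
    have ht0 := ht.1
    have hjordan : π⁻¹ * t ≤ |sin (t / 2)| := by
      have hj := mul_abs_le_abs_sin (x := t / 2)
        (by rw [abs_of_pos (by linarith)]; linarith [ht.2])
      rw [abs_of_pos (by linarith : 0 < t / 2)] at hj
      calc _ = 2 / π * (t / 2) := by field_simp
        _ ≤ _ := hj
    rw [← mul_rpow (by positivity) ht0.le, norm_of_nonneg (by positivity),
      norm_of_nonneg (by positivity)]
    exact rpow_le_rpow_of_nonpos (by positivity) hjordan hβ0
  have hneg : IntervalIntegrable (fun t => |sin (t / 2)| ^ β) volume (-π) 0 := by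
    have hcomp := hhalf.comp_mul_left (c := -1)
    simpa [neg_div, div_neg] using hcomp.symm
  refine hper.intervalIntegrable two_pi_pos.ne' (t := -π) ?_ a b
  rw [show -π + 2 * π = π by ring]
  exact hneg.trans hhalf

theorem integrableOn_comp_sub {g : ℝ → ℝ} {a b c d : ℝ}
    (hg : IntegrableOn g (Set.Icc (a - d) (b - c))) :
    IntegrableOn (fun p : ℝ × ℝ => g (p.1 - p.2)) (Set.Icc a b ×ˢ Set.Icc c d) := by
  have hone : Integrable ((Set.Icc c d).indicator fun _ : ℝ => (1 : ℝ)) :=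
    (integrable_indicator_iff measurableSet_Icc).2 (integrableOn_const (by simp))
  have hconv := hone.convolution_integrand (ContinuousLinearMap.mul ℝ ℝ)
    ((integrable_indicator_iff measurableSet_Icc).2 hg)
  refine (hconv.integrableOn (s := Set.Icc a b ×ˢ Set.Icc c d)).congr_fun (fun p hp => ?_)
    (measurableSet_Icc.prod measurableSet_Icc)
  obtain ⟨⟨h1, h2⟩, h3⟩ := hp
  have hmem : p.1 - p.2 ∈ Set.Icc (a - d) (b - c) :=
    ⟨by linarith [h3.2], by linarith [h3.1]⟩
  simp [Set.indicator_of_mem h3, Set.indicator_of_mem hmem]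

theorem integrableOn_Fcde {α : ℝ} (hα : α ∈ Set.Ioo (0 : ℝ) 2) {h : ℝ → ℝ}
    (hper : Function.Periodic h (2 * π)) (hreg : ContDiff ℝ 2 h) (hpos : ∀ x, 0 < 1 + h x) :
    IntegrableOn (fun p : ℝ × ℝ => Fcde α h p.1 p.2) (Set.Icc (-π) π ×ˢ Set.Icc (-π) π) := by
  obtain ⟨C, -, hF⟩ := abs_Fcde_le hα.1.le hper hreg hpos
  have hβ : -1 < min 0 (1 - α) := lt_min (by norm_num) (by linarith [hα.2])
  have hint := (intervalIntegrable_iff_integrableOn_Icc_of_le (by linarith [pi_pos])).1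
    (intervalIntegrable_abs_sin_half_rpow hβ (min_le_left _ _) (-π - π) (π - -π))
  have hmeas : Measurable fun p : ℝ × ℝ => Fcde α h p.1 p.2 := by
    have hcont := hreg.continuous
    have hcont' := hreg.continuous_deriv (by norm_num)
    unfold Fcde Dden
    fun_prop
  exact ((integrableOn_comp_sub hint).const_mul C).mono' hmeas.aestronglyMeasurable
    (ae_of_all _ fun p => hF p.1 p.2)

theorem Fcde_swap (α : ℝ) (h : ℝ → ℝ) (x y : ℝ) : Fcde α h y x = -Fcde α h x y := by
  have hD : Dden h y x = Dden h x y := by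
    rw [Dden, Dden, ← cos_neg (x - y), neg_sub]; ring
  rw [Fcde, Fcde, hD, ← neg_sub x y, cos_neg, sin_neg]; ring

theorem intervalIntegral_intervalIntegral_eq_zero_of_antisymm {F : ℝ → ℝ → ℝ} {a b : ℝ}
    (hF : ∀ x y, F y x = -F x y)
    (hint : IntegrableOn (Function.uncurry F) (Set.uIoc a b ×ˢ Set.uIoc a b)) :
    ∫ x in a..b, ∫ y in a..b, F x y = 0 := by
  have hswap := intervalIntegral_intervalIntegral_swap hint
  have hneg : ∫ y in a..b, ∫ x in a..b, F x y = -∫ x in a..b, ∫ y in a..b, F x y := by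
    simp_rw [← intervalIntegral.integral_neg, ← hF]
  linarith

/-- Zero average of the contour dynamics nonlinearity (conservation of the patch area):
for `α ∈ (0,2)` and a `2π`-periodic `C²` function `h` with `1 + h > 0` and positive
denominator off the diagonal, `F` is Lebesgue integrable on `[−π,π]²` and
`∫_{−π}^{π}∫_{−π}^{π} F(x,y) dy dx = 0`. -/
theorem contour_nonlinearity_zero_average (α : ℝ) (hα : α ∈ Set.Ioo (0 : ℝ) 2)
    (h : ℝ → ℝ) (hper : ∀ x, h (x + 2 * π) = h x) (hreg : ContDiff ℝ 2 h)
    (hpos : ∀ x, 0 < 1 + h x)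
    (hD : ∀ x y : ℝ, (∀ k : ℤ, x - y ≠ 2 * π * k) → 0 < Dden h x y) :
    IntegrableOn (fun p : ℝ × ℝ => Fcde α h p.1 p.2)
        (Set.Icc (-π) π ×ˢ Set.Icc (-π) π) ∧
    (∫ x in (-π)..π, ∫ y in (-π)..π, Fcde α h x y) = 0 := by
  have hint := integrableOn_Fcde hα hper hreg hpos
  refine ⟨hint, intervalIntegral_intervalIntegral_eq_zero_of_antisymm (Fcde_swap α h) ?_⟩
  rw [Set.uIoc_of_le (by linarith [pi_pos])]
  exact hint.mono_set (Set.prod_mono Set.Ioc_subset_Icc_self Set.Ioc_subset_Icc_self)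
end

section
/- Linearization of the pseudo-energy gradient at the disk (Lemma 3.1, Fourier form). Let α ∈ (0,2). For every j ∈ ℤ, the function of z (defined for z ∈ (−π,π)∖{0}) given by [ 2e^{−ijz} − (1+e^{−ijz})·cos z + i·j·e^{−ijz}·sin z ]·(2(1−cos z))^{−α/2} − (α/4)·(1+e^{−ijz})·(2(1−cos z))^{1−α/2} is Lebesgue integrable on (−π,π), and (c_α/(2−α))·(1/2π)·∫_{−π}^{π} { [ 2e^{−ijz} − (1+e^{−ijz})·cos z + i·j·e^{−ijz}·sin z ]·(2(1−cos z))^{−α/2} − (α/4)·(1+e^{−ijz})·(2(1−cos z))^{1−α/2} } dz = −L_α(|j|). Equivalently, the differential of the pseudo-energy gradient at f = 0 acts diagonally on the Fourier mode e^{ijx} with eigenvalue −L_α(|j|). -/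
open Real MeasureTheory

/-- `c_α := Γ(α/2)/(2^{1−α}·Γ(1−α/2))`. -/
noncomputable def cAlpha (α : ℝ) : ℝ :=
  Real.Gamma (α / 2) / (2 ^ (1 - α) * Real.Gamma (1 - α / 2))

/-- `T¹_α(n)`. -/
noncomputable def T1 (α : ℝ) (n : ℕ) : ℝ :=
  (Real.Gamma (2 - α) / (Real.Gamma (1 - α / 2) * Real.Gamma (α / 2))) *
    ∑ k ∈ Finset.range n,
      Real.Gamma (α / 2 + k) / ((1 - α / 2 + k) * Real.Gamma (1 - α / 2 + k))

/-- `T²_α(n)`. -/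
noncomputable def T2 (α : ℝ) (n : ℕ) : ℝ :=
  (Real.Gamma (2 - α) / (Real.Gamma (1 - α / 2) * Real.Gamma (α / 2))) *
    (Real.Gamma (α / 2 + n) / Real.Gamma (1 - α / 2 + n))

/-- `L_α(n)`. -/
noncomputable def Lsymb (α : ℝ) (n : ℕ) : ℝ :=
  (cAlpha α / (2 - α)) *
    (T1 α n - T2 α n - Real.Gamma (2 - α) / (Real.Gamma (1 - α / 2)) ^ 2)

/-- Linear frequency `ω_α(j) := j·L_α(|j|)`. -/
noncomputable def omega (α : ℝ) (j : ℤ) : ℝ := (j : ℝ) * Lsymb α j.natAbs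
/-- The integrand of the linearization of the pseudo-energy gradient at the disk. -/
noncomputable def linIntegrand (α : ℝ) (j : ℤ) (z : ℝ) : ℂ :=
  (2 * Complex.exp (-Complex.I * j * z)
      - (1 + Complex.exp (-Complex.I * j * z)) * (Real.cos z : ℂ)
      + Complex.I * j * Complex.exp (-Complex.I * j * z) * (Real.sin z : ℂ))
    * (((2 * (1 - Real.cos z)) ^ (-(α / 2)) : ℝ) : ℂ)
  - ((α / 4 : ℝ) : ℂ) * (1 + Complex.exp (-Complex.I * j * z))
    * (((2 * (1 - Real.cos z)) ^ (1 - α / 2) : ℝ) : ℂ)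

/-- The real Beta integral over the open unit interval. -/
lemma integral_Ioo_rpow_mul_one_sub_rpow {u v : ℝ} (hu : 0 < u) (hv : 0 < v) :
    ∫ x in Set.Ioo (0 : ℝ) 1, x ^ (u - 1) * (1 - x) ^ (v - 1)
      = Real.Gamma u * Real.Gamma v / Real.Gamma (u + v) := by
  have h := Complex.betaIntegral_eq_Gamma_mul_div (u : ℂ) (v : ℂ) (by simpa) (by simpa)
  rw [← Complex.ofReal_add, Complex.Gamma_ofReal, Complex.Gamma_ofReal, Complex.Gamma_ofReal,
    Complex.betaIntegral, intervalIntegral.integral_of_le zero_le_one,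
    integral_Ioc_eq_integral_Ioo] at h
  rw [← Complex.ofReal_inj, ← integral_complex_ofReal]
  push_cast
  rw [← h]
  refine setIntegral_congr_fun measurableSet_Ioo fun x hx => ?_
  rw [Complex.ofReal_cpow hx.1.le, Complex.ofReal_cpow (by linarith [hx.2])]
  push_cast
  rfl

lemma one_sub_cos_nonneg (z : ℝ) : 0 ≤ 2 * (1 - Real.cos z) := by
  linarith [Real.cos_le_one z]

lemma image_one_sub_cos_div_two_Ioo :
    (fun z : ℝ => (1 - Real.cos z) / 2) '' Set.Ioo 0 π = Set.Ioo 0 1 := by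
  ext x
  constructor
  · rintro ⟨z, hz, rfl⟩
    have h1 := Real.cos_lt_cos_of_nonneg_of_le_pi le_rfl hz.2.le hz.1
    have h2 := Real.cos_lt_cos_of_nonneg_of_le_pi hz.1.le le_rfl hz.2
    rw [Real.cos_zero] at h1
    rw [Real.cos_pi] at h2
    constructor <;> simp only <;> linarith
  · intro hx
    refine ⟨Real.arccos (1 - 2 * x), ⟨?_, ?_⟩, ?_⟩
    · exact Real.arccos_pos.2 (by linarith [hx.1])
    · refine lt_of_le_of_ne (Real.arccos_le_pi _) fun h => ?_
      rw [Real.arccos_eq_pi] at h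
      linarith [hx.2]
    · simp only
      rw [Real.cos_arccos (by linarith [hx.2]) (by linarith [hx.1])]
      ring

lemma integral_Ioo_one_sub_cos_rpow {s : ℝ} (hs : 0 < s) :
    ∫ z in Set.Ioo 0 π, (2 * (1 - Real.cos z)) ^ s
      = π * Real.Gamma (2 * s + 1) / Real.Gamma (s + 1) ^ 2 := by
  have hsub := integral_image_eq_integral_abs_deriv_smul
    (s := Set.Ioo 0 π) (f := fun z : ℝ => (1 - Real.cos z) / 2) (f' := fun z => Real.sin z / 2)
    measurableSet_Ioo
    (fun x _ => by
      have := (((Real.hasDerivAt_cos x).const_sub 1).div_const 2).hasDerivWithinAt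
        (s := Set.Ioo 0 π)
      simpa using this)
    (fun x hx y hy hxy => by
      refine Real.injOn_cos ⟨hx.1.le, hx.2.le⟩ ⟨hy.1.le, hy.2.le⟩ ?_
      simp only at hxy
      linarith)
    (fun x => x ^ ((s + 1 / 2) - 1) * (1 - x) ^ ((1 / 2 : ℝ) - 1))
  rw [image_one_sub_cos_div_two_Ioo,
    integral_Ioo_rpow_mul_one_sub_rpow (by positivity) (by norm_num)] at hsub
  have hpt : ∀ z ∈ Set.Ioo 0 π, (2 * (1 - Real.cos z)) ^ s
      = 4 ^ s * (|Real.sin z / 2| • (((1 - Real.cos z) / 2) ^ ((s + 1 / 2) - 1)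
        * (1 - (1 - Real.cos z) / 2) ^ ((1 / 2 : ℝ) - 1))) := by
    intro z hz
    obtain ⟨h0, h1⟩ : (1 - Real.cos z) / 2 ∈ Set.Ioo (0 : ℝ) 1 := by
      rw [← image_one_sub_cos_div_two_Ioo]
      exact ⟨z, hz, rfl⟩
    have hsin := Real.sin_pos_of_pos_of_lt_pi hz.1 hz.2
    have hsq : Real.sin z / 2 = ((1 - Real.cos z) / 2) ^ (1 / 2 : ℝ)
        * (1 - (1 - Real.cos z) / 2) ^ (1 / 2 : ℝ) := by
      rw [← Real.mul_rpow h0.le (by linarith), ← Real.sqrt_eq_rpow, eq_comm,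
        Real.sqrt_eq_iff_mul_self_eq_of_pos (by positivity)]
      nlinarith [Real.sin_sq_add_cos_sq z]
    rw [abs_of_pos (by positivity), hsq, smul_eq_mul]
    have e1 : 2 * (1 - Real.cos z) = 4 * ((1 - Real.cos z) / 2) := by ring
    rw [e1, Real.mul_rpow (by norm_num) h0.le]
    generalize (1 - Real.cos z) / 2 = x at *
    have h1' : 0 < 1 - x := by linarith
    have e2 : x ^ s = x ^ (1 / 2 : ℝ) * x ^ ((s + 1 / 2) - 1) := by
      rw [← Real.rpow_add h0]; ring_nf
    have e3 : (1 - x) ^ (1 / 2 : ℝ) * (1 - x) ^ ((1 / 2 : ℝ) - 1) = 1 := by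
      rw [← Real.rpow_add h1']; norm_num
    rw [e2]
    linear_combination (-(4 ^ s * x ^ (1 / 2 : ℝ) * x ^ ((s + 1 / 2) - 1))) * e3
  rw [setIntegral_congr_fun measurableSet_Ioo hpt, integral_const_mul, ← hsub]
  have hleg := Real.Gamma_mul_Gamma_add_half (s + 1 / 2)
  have e4 : s + 1 / 2 + 1 / 2 = s + 1 := by ring
  rw [e4] at hleg ⊢
  have hG : Real.Gamma (s + 1) ≠ 0 := (Real.Gamma_pos_of_pos (by linarith)).ne'
  have hG' : Real.Gamma (s + 1 / 2)
      = Real.Gamma (2 * s + 1) * (4 ^ s)⁻¹ * √π / Real.Gamma (s + 1) := by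
    rw [eq_div_iff hG, hleg]
    congr 2
    · ring_nf
    · rw [← Real.rpow_neg (by norm_num), show (4 : ℝ) = 2 ^ (2 : ℝ) by norm_num,
        ← Real.rpow_mul (by norm_num)]
      ring_nf
  rw [hG', Real.Gamma_one_half_eq]
  have h4 : (4 : ℝ) ^ s ≠ 0 := by positivity
  have hpi : √π * √π = π := Real.mul_self_sqrt Real.pi_pos.le
  field_simp
  linear_combination hpi

lemma continuous_one_sub_cos_rpow {s : ℝ} (hs : 0 < s) :
    Continuous fun z : ℝ => (2 * (1 - Real.cos z)) ^ s :=
  Continuous.rpow_const (by fun_prop) fun _ => Or.inr hs.le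

lemma integral_one_sub_cos_rpow {s : ℝ} (hs : 0 < s) :
    ∫ z in (-π)..π, (2 * (1 - Real.cos z)) ^ s
      = 2 * π * Real.Gamma (2 * s + 1) / Real.Gamma (s + 1) ^ 2 := by
  have hc := continuous_one_sub_cos_rpow hs
  have h0 : ∫ z in (0)..π, (2 * (1 - Real.cos z)) ^ s
      = π * Real.Gamma (2 * s + 1) / Real.Gamma (s + 1) ^ 2 := by
    rw [intervalIntegral.integral_of_le Real.pi_pos.le, integral_Ioc_eq_integral_Ioo,
      integral_Ioo_one_sub_cos_rpow hs]
  have h1 : ∫ z in (-π)..0, (2 * (1 - Real.cos z)) ^ s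
      = ∫ z in (0)..π, (2 * (1 - Real.cos z)) ^ s := by
    have := intervalIntegral.integral_comp_neg (a := 0) (b := π)
      fun z : ℝ => (2 * (1 - Real.cos z)) ^ s
    simp only [Real.cos_neg, neg_zero] at this
    exact this.symm
  rw [← intervalIntegral.integral_add_adjacent_intervals (hc.intervalIntegrable _ 0)
    (hc.intervalIntegrable 0 _), h1, h0]
  ring

/-- Divisibility of the trigonometric polynomials `1 - cos (n z)`, `sin z * sin (n z)` and
`sin (n z) - n sin z` by `2 (1 - cos z)`, with continuous quotients. -/
lemma exists_continuous_trig_quotients (n : ℕ) : ∃ p q r : ℝ → ℝ,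
    Continuous p ∧ Continuous q ∧ Continuous r ∧
    (∀ z, 1 - Real.cos (n * z) = 2 * (1 - Real.cos z) * p z) ∧
    (∀ z, Real.sin z * Real.sin (n * z) = 2 * (1 - Real.cos z) * q z) ∧
    (∀ z, Real.sin (n * z) - n * Real.sin z = 2 * (1 - Real.cos z) * r z) := by
  induction n with
  | zero =>
    exact ⟨fun _ => 0, fun _ => 0, fun _ => 0, continuous_const, continuous_const,
      continuous_const, by simp, by simp, by simp⟩
  | succ n ih =>
    obtain ⟨p, q, r, hp, hq, hr, ep, eq, er⟩ := ih
    refine ⟨fun z => p z * Real.cos z + 1 / 2 + q z,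
      fun z => q z * Real.cos z + Real.cos (n * z) * (1 + Real.cos z) / 2,
      fun z => r z - Real.sin (n * z) / 2 - Real.sin z * p z, by fun_prop, by fun_prop,
      by fun_prop, fun z => ?_, fun z => ?_, fun z => ?_⟩
    · push_cast
      rw [add_one_mul, Real.cos_add]
      linear_combination Real.cos z * ep z + eq z
    · push_cast
      rw [add_one_mul, Real.sin_add]
      linear_combination Real.cos z * eq z + Real.cos (n * z) * Real.sin_sq_add_cos_sq z
    · push_cast
      rw [add_one_mul, Real.sin_add]
      linear_combination er z - Real.sin z * ep z

lemma mul_rpow_sub_one {x s : ℝ} (hx : 0 ≤ x) (hs : 0 < s) : x * x ^ (s - 1) = x ^ s := by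
  rw [← Real.rpow_one_add' hx (by simpa using hs.ne')]
  ring_nf

/-- Fourier cosine coefficients of `(2 (1 - cos z)) ^ s`. -/
noncomputable def cosCoeff (s : ℝ) (n : ℕ) : ℝ :=
  ∫ z in (-π)..π, Real.cos (n * z) * (2 * (1 - Real.cos z)) ^ s

lemma continuous_sin_mul_sin_mul_rpow {s : ℝ} (hs : 0 < s) (n : ℕ) :
    Continuous fun z : ℝ =>
      Real.sin z * Real.sin (n * z) * (2 * (1 - Real.cos z)) ^ (s - 1) := by
  obtain ⟨p, q, r, -, hq, -, -, eq, -⟩ := exists_continuous_trig_quotients n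
  refine (hq.mul (continuous_one_sub_cos_rpow hs)).congr fun z => ?_
  change q z * (2 * (1 - Real.cos z)) ^ s = _
  rw [eq, ← mul_rpow_sub_one (one_sub_cos_nonneg z) hs]
  ring

lemma continuous_one_sub_cos_mul_rpow {s : ℝ} (hs : 0 < s) (n : ℕ) :
    Continuous fun z : ℝ => (1 - Real.cos (n * z)) * (2 * (1 - Real.cos z)) ^ (s - 1) := by
  obtain ⟨p, q, r, hp, -, -, ep, -, -⟩ := exists_continuous_trig_quotients n
  refine (hp.mul (continuous_one_sub_cos_rpow hs)).congr fun z => ?_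
  change p z * (2 * (1 - Real.cos z)) ^ s = _
  rw [ep, ← mul_rpow_sub_one (one_sub_cos_nonneg z) hs]
  ring

/-- Integration by parts for the cosine coefficients. -/
lemma nat_mul_cosCoeff {s : ℝ} (hs : 0 < s) (n : ℕ) :
    n * cosCoeff s n = -(2 * s) *
      ∫ z in (-π)..π, Real.sin z * Real.sin (n * z) * (2 * (1 - Real.cos z)) ^ (s - 1) := by
  have hc1 : Continuous fun z : ℝ => (n : ℝ) * (Real.cos (n * z) * (2 * (1 - Real.cos z)) ^ s) :=
    continuous_const.mul ((by fun_prop : Continuous fun z : ℝ => Real.cos (n * z)).mul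
      (continuous_one_sub_cos_rpow hs))
  have hc2 : Continuous fun z : ℝ => 2 * s *
      (Real.sin z * Real.sin (n * z) * (2 * (1 - Real.cos z)) ^ (s - 1)) :=
    continuous_const.mul (continuous_sin_mul_sin_mul_rpow hs n)
  have key := integral_eq_of_hasDerivAt_off_countable_of_le
    (fun z : ℝ => Real.sin (n * z) * (2 * (1 - Real.cos z)) ^ s)
    (fun z : ℝ => (n : ℝ) * (Real.cos (n * z) * (2 * (1 - Real.cos z)) ^ s) + 2 * s *
      (Real.sin z * Real.sin (n * z) * (2 * (1 - Real.cos z)) ^ (s - 1)))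
    (a := -π) (b := π) (by linarith [Real.pi_pos]) (Set.countable_singleton (0 : ℝ))
    (((by fun_prop : Continuous fun z : ℝ => Real.sin (n * z)).mul
      (continuous_one_sub_cos_rpow hs)).continuousOn)
    (fun z hz => by
      have hne : 2 * (1 - Real.cos z) ≠ 0 := by
        intro h
        refine hz.2 ((Real.cos_eq_one_iff_of_lt_of_lt ?_ ?_).1 (by linarith))
        · linarith [hz.1.1, Real.pi_pos]
        · linarith [hz.1.2, Real.pi_pos]
      have h1 : HasDerivAt (fun z : ℝ => Real.sin (n * z)) (Real.cos (n * z) * n) z := by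
        simpa using ((hasDerivAt_id z).const_mul (n : ℝ)).sin
      have h2 : HasDerivAt (fun z : ℝ => 2 * (1 - Real.cos z)) (2 * Real.sin z) z := by
        simpa using ((Real.hasDerivAt_cos z).const_sub 1).const_mul 2
      refine (h1.mul (h2.rpow_const (p := s) (Or.inl hne))).congr_deriv ?_
      ring)
    ((hc1.add hc2).intervalIntegrable _ _)
  rw [intervalIntegral.integral_add (hc1.intervalIntegrable _ _) (hc2.intervalIntegrable _ _),
    intervalIntegral.integral_const_mul, intervalIntegral.integral_const_mul] at key
  have hb : Real.sin (n * π) = 0 := Real.sin_nat_mul_pi n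
  have hb' : Real.sin (n * -π) = 0 := by rw [mul_neg, Real.sin_neg, hb, neg_zero]
  rw [hb, hb'] at key
  rw [cosCoeff]
  linarith

lemma cosCoeff_zero {s : ℝ} (hs : 0 < s) :
    cosCoeff s 0 = 2 * π * Real.Gamma (2 * s + 1) / Real.Gamma (s + 1) ^ 2 := by
  rw [← integral_one_sub_cos_rpow hs, cosCoeff]
  simp

lemma continuous_cos_mul_rpow {s : ℝ} (hs : 0 < s) (n : ℕ) :
    Continuous fun z : ℝ => Real.cos (n * z) * (2 * (1 - Real.cos z)) ^ s :=
  (by fun_prop : Continuous fun z : ℝ => Real.cos (n * z)).mul (continuous_one_sub_cos_rpow hs)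

lemma cosCoeff_succ {s : ℝ} (hs : 0 < s) (n : ℕ) :
    (n + 1 + s) * cosCoeff s (n + 1) = (n - s) * cosCoeff s n := by
  have h0 := nat_mul_cosCoeff hs n
  have h1 := nat_mul_cosCoeff hs (n + 1)
  have hsum : cosCoeff s n + cosCoeff s (n + 1) = 2 *
      ((∫ z in (-π)..π, Real.sin z * Real.sin ((n + 1 : ℕ) * z)
          * (2 * (1 - Real.cos z)) ^ (s - 1)) -
        ∫ z in (-π)..π, Real.sin z * Real.sin (n * z) * (2 * (1 - Real.cos z)) ^ (s - 1)) := by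
    rw [cosCoeff, cosCoeff, ← intervalIntegral.integral_add
        ((continuous_cos_mul_rpow hs n).intervalIntegrable _ _)
        ((continuous_cos_mul_rpow hs (n + 1)).intervalIntegrable _ _),
      ← intervalIntegral.integral_sub
        ((continuous_sin_mul_sin_mul_rpow hs (n + 1)).intervalIntegrable _ _)
        ((continuous_sin_mul_sin_mul_rpow hs n).intervalIntegrable _ _),
      ← intervalIntegral.integral_const_mul]
    refine intervalIntegral.integral_congr fun z _ => ?_
    rw [← mul_rpow_sub_one (one_sub_cos_nonneg z) hs]
    push_cast
    rw [add_one_mul, Real.cos_add, Real.sin_add]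
    linear_combination (-2 * Real.cos (n * z) * (2 * (1 - Real.cos z)) ^ (s - 1))
      * Real.sin_sq_add_cos_sq z
  push_cast at h0 h1 hsum ⊢
  linear_combination h1 - h0 + s * hsum

/-- The integral of `1 - cos (n z)` against the kernel `(2 (1 - cos z)) ^ (s - 1)`. -/
noncomputable def regCoeff (s : ℝ) (n : ℕ) : ℝ :=
  ∫ z in (-π)..π, (1 - Real.cos (n * z)) * (2 * (1 - Real.cos z)) ^ (s - 1)

lemma regCoeff_zero (s : ℝ) : regCoeff s 0 = 0 := by simp [regCoeff]

lemma regCoeff_one {s : ℝ} (hs : 0 < s) : regCoeff s 1 = cosCoeff s 0 / 2 := by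
  rw [regCoeff, cosCoeff, ← intervalIntegral.integral_div]
  refine intervalIntegral.integral_congr fun z _ => ?_
  rw [← mul_rpow_sub_one (one_sub_cos_nonneg z) hs]
  simp
  ring

lemma regCoeff_add_two {s : ℝ} (hs : 0 < s) (n : ℕ) :
    regCoeff s (n + 2) - regCoeff s (n + 1)
      = regCoeff s (n + 1) - regCoeff s n + cosCoeff s (n + 1) := by
  have hi := fun m => (continuous_one_sub_cos_mul_rpow hs m).intervalIntegrable
    (μ := volume) (-π) π
  rw [regCoeff, regCoeff, regCoeff, cosCoeff, ← intervalIntegral.integral_sub (hi _) (hi _),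
    ← intervalIntegral.integral_sub (hi _) (hi _), ← intervalIntegral.integral_add
      ((hi _).sub (hi _)) ((continuous_cos_mul_rpow hs (n + 1)).intervalIntegrable _ _)]
  refine intervalIntegral.integral_congr fun z _ => ?_
  rw [← mul_rpow_sub_one (one_sub_cos_nonneg z) hs]
  push_cast
  have e1 : ((n : ℝ) + 2) * z = (n + 1) * z + z := by ring
  have e2 : (n : ℝ) * z = (n + 1) * z - z := by ring
  rw [e1, e2, Real.cos_add, Real.cos_sub]
  ring

lemma regCoeff_succ_sub {s : ℝ} (hs : 0 < s) (n : ℕ) :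
    2 * s * (regCoeff s (n + 1) - regCoeff s n) = (s - n) * cosCoeff s n := by
  induction n with
  | zero => rw [regCoeff_zero, regCoeff_one hs]; push_cast; ring
  | succ n ih =>
    rw [regCoeff_add_two hs, mul_add, ih]
    have := cosCoeff_succ hs n
    push_cast
    linear_combination this

lemma cosCoeff_eq_T2 {α : ℝ} (h0 : 0 < α) (h2 : α < 2) (n : ℕ) :
    ((1 - α / 2) ^ 2 - n ^ 2) * cosCoeff (1 - α / 2) n = 2 * (1 - α / 2) * (2 * π * T2 α n) := by
  have hs : 0 < 1 - α / 2 := by linarith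
  induction n with
  | zero =>
    have g1 := (Real.Gamma_pos_of_pos hs).ne'
    have g := (Real.Gamma_pos_of_pos (half_pos h0)).ne'
    rw [cosCoeff_zero hs, Real.Gamma_add_one hs.ne', T2,
      show 2 * (1 - α / 2) + 1 = (2 - α) + 1 by ring, Real.Gamma_add_one (by linarith)]
    simp only [Nat.cast_zero, add_zero]
    have : 2 - α ≠ 0 := by linarith
    field_simp
    ring
  | succ n ih =>
    have hn : (0 : ℝ) ≤ n := n.cast_nonneg
    have hd : 1 - α / 2 + n ≠ 0 := by linarith
    have hT : (1 - α / 2 + n) * T2 α (n + 1) = (α / 2 + n) * T2 α n := by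
      have g1 : Real.Gamma (1 - α / 2 + n) ≠ 0 := (Real.Gamma_pos_of_pos (by linarith)).ne'
      rw [T2, T2]
      push_cast
      rw [← add_assoc, ← add_assoc, Real.Gamma_add_one hd,
        Real.Gamma_add_one (by linarith : α / 2 + n ≠ 0)]
      generalize 1 - α / 2 + (n : ℝ) = x at hd g1 ⊢
      field_simp
    have hr := cosCoeff_succ hs n
    apply mul_left_cancel₀ hd
    push_cast
    linear_combination (1 - α / 2 - n - 1) * (1 - α / 2 + n) * hr + (α / 2 + n) * ih
      - 2 * (1 - α / 2) * 2 * π * hT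

lemma regCoeff_eq_T1 {α : ℝ} (h0 : 0 < α) (h2 : α < 2) (n : ℕ) :
    regCoeff (1 - α / 2) n = 2 * π * T1 α n := by
  have hs : 0 < 1 - α / 2 := by linarith
  induction n with
  | zero => simp [regCoeff_zero, T1]
  | succ n ih =>
    have hn : (0 : ℝ) ≤ n := n.cast_nonneg
    have hd : 1 - α / 2 + n ≠ 0 := by linarith
    have hT : (1 - α / 2 + n) * (T1 α (n + 1) - T1 α n) = T2 α n := by
      have g1 : Real.Gamma (1 - α / 2 + n) ≠ 0 := (Real.Gamma_pos_of_pos (by linarith)).ne'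
      rw [T1, T1, T2, Finset.sum_range_succ]
      generalize 1 - α / 2 + (n : ℝ) = x at hd g1 ⊢
      field_simp
      ring
    have h := regCoeff_succ_sub hs n
    have hA := cosCoeff_eq_T2 h0 h2 n
    apply mul_left_cancel₀ (mul_ne_zero (mul_ne_zero two_ne_zero hs.ne') hd)
    linear_combination (1 - α / 2 + n) * h + hA + 2 * (1 - α / 2) * (1 - α / 2 + n) * ih
      - 2 * (1 - α / 2) * 2 * π * hT

/-- Real part of the linearized integrand. -/
noncomputable def linRe (α : ℝ) (n : ℕ) (z : ℝ) : ℝ :=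
  -((1 - Real.cos (n * z)) * (2 * (1 - Real.cos z)) ^ ((1 - α / 2) - 1))
    + n * (Real.sin z * Real.sin (n * z) * (2 * (1 - Real.cos z)) ^ ((1 - α / 2) - 1))
    + (1 - α / 2) / 2 * (Real.cos ((0 : ℕ) * z) * (2 * (1 - Real.cos z)) ^ (1 - α / 2)
      + Real.cos (n * z) * (2 * (1 - Real.cos z)) ^ (1 - α / 2))

/-- Imaginary part of the linearized integrand. -/
noncomputable def linIm (α : ℝ) (n : ℕ) (z : ℝ) : ℝ :=
  -(Real.sin (n * z) - n * Real.sin z * Real.cos (n * z))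
      * (2 * (1 - Real.cos z)) ^ ((1 - α / 2) - 1)
    - (1 - α / 2) / 2 * (Real.sin (n * z) * (2 * (1 - Real.cos z)) ^ (1 - α / 2))

lemma linIntegrand_natCast {α : ℝ} (h2 : α < 2) (n : ℕ) (z : ℝ) :
    linIntegrand α n z = (linRe α n z : ℂ) + Complex.I * (linIm α n z : ℂ) := by
  have hs : 0 < 1 - α / 2 := by linarith
  have he : Complex.exp (-Complex.I * ((n : ℤ) : ℂ) * z)
      = ((Real.cos (n * z) : ℝ) : ℂ) - Complex.I * ((Real.sin (n * z) : ℝ) : ℂ) := by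
    have : -Complex.I * ((n : ℤ) : ℂ) * z = ((-(n * z) : ℝ) : ℂ) * Complex.I := by
      push_cast; ring
    rw [this, Complex.exp_mul_I, ← Complex.ofReal_cos, ← Complex.ofReal_sin, Real.cos_neg,
      Real.sin_neg]
    push_cast
    ring
  rw [linIntegrand, he, linRe, linIm, show -(α / 2) = (1 - α / 2) - 1 by ring,
    ← mul_rpow_sub_one (one_sub_cos_nonneg z) hs]
  generalize (2 * (1 - Real.cos z)) ^ ((1 - α / 2) - 1) = d
  simp only [Nat.cast_zero, zero_mul, Real.cos_zero]
  push_cast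
  ring_nf
  simp only [Complex.I_sq]
  ring

lemma continuous_linRe {α : ℝ} (h2 : α < 2) (n : ℕ) : Continuous (linRe α n) := by
  have hs : 0 < 1 - α / 2 := by linarith
  exact ((continuous_one_sub_cos_mul_rpow hs n).neg.add
    (continuous_const.mul (continuous_sin_mul_sin_mul_rpow hs n))).add
    (continuous_const.mul ((continuous_cos_mul_rpow hs 0).add (continuous_cos_mul_rpow hs n)))

lemma continuous_linIm {α : ℝ} (h2 : α < 2) (n : ℕ) : Continuous (linIm α n) := by
  have hs : 0 < 1 - α / 2 := by linarith
  obtain ⟨p, q, r, hp, -, hr, ep, -, er⟩ := exists_continuous_trig_quotients n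
  have hd := continuous_one_sub_cos_rpow hs
  have hc : Continuous fun z : ℝ =>
      -(r z + n * (Real.sin z * p z)) * (2 * (1 - Real.cos z)) ^ (1 - α / 2)
      - (1 - α / 2) / 2 * (Real.sin (n * z) * (2 * (1 - Real.cos z)) ^ (1 - α / 2)) := by
    fun_prop
  refine hc.congr fun z => ?_
  rw [linIm, ← mul_rpow_sub_one (one_sub_cos_nonneg z) hs]
  linear_combination (2 * (1 - Real.cos z)) ^ ((1 - α / 2) - 1) *
    (er z + n * Real.sin z * ep z)

lemma integral_linIm (α : ℝ) (n : ℕ) : ∫ z in (-π)..π, linIm α n z = 0 := by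
  have h := intervalIntegral.integral_comp_neg (a := -π) (b := π) (linIm α n)
  have hodd : ∀ z, linIm α n (-z) = -linIm α n z := fun z => by
    simp only [linIm, mul_neg, Real.sin_neg, Real.cos_neg]
    ring
  simp only [hodd, intervalIntegral.integral_neg, neg_neg] at h
  linarith

lemma integral_linRe {α : ℝ} (h0 : 0 < α) (h2 : α < 2) (n : ℕ) :
    ∫ z in (-π)..π, linRe α n z
      = -(2 * π) * (T1 α n - T2 α n - Real.Gamma (2 - α) / Real.Gamma (1 - α / 2) ^ 2) := by
  have hs : 0 < 1 - α / 2 := by linarith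
  have i1 := (continuous_one_sub_cos_mul_rpow hs n).intervalIntegrable (μ := volume) (-π) π
  have i2 := (continuous_sin_mul_sin_mul_rpow hs n).intervalIntegrable (μ := volume) (-π) π
  have i3 := (continuous_cos_mul_rpow hs 0).intervalIntegrable (μ := volume) (-π) π
  have i4 := (continuous_cos_mul_rpow hs n).intervalIntegrable (μ := volume) (-π) π
  have hsplit : ∫ z in (-π)..π, linRe α n z = -regCoeff (1 - α / 2) n
      + n * (∫ z in (-π)..π, Real.sin z * Real.sin (n * z)
          * (2 * (1 - Real.cos z)) ^ ((1 - α / 2) - 1))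
      + (1 - α / 2) / 2 * (cosCoeff (1 - α / 2) 0 + cosCoeff (1 - α / 2) n) := by
    have i1' : IntervalIntegrable (fun z => -((1 - Real.cos (n * z))
        * (2 * (1 - Real.cos z)) ^ ((1 - α / 2) - 1))) volume (-π) π := i1.neg
    simp only [linRe]
    rw [intervalIntegral.integral_add (i1'.add (i2.const_mul _)) ((i3.add i4).const_mul _),
      intervalIntegral.integral_add i1' (i2.const_mul _), intervalIntegral.integral_neg,
      intervalIntegral.integral_const_mul, intervalIntegral.integral_const_mul,
      intervalIntegral.integral_add i3 i4]
    rfl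
  have hibp := nat_mul_cosCoeff hs n
  have hT2 := cosCoeff_eq_T2 h0 h2 n
  have hA0 : (1 - α / 2) / 2 * cosCoeff (1 - α / 2) 0
      = 2 * π * (Real.Gamma (2 - α) / Real.Gamma (1 - α / 2) ^ 2) := by
    have g1 := (Real.Gamma_pos_of_pos hs).ne'
    rw [cosCoeff_zero hs, Real.Gamma_add_one hs.ne',
      show 2 * (1 - α / 2) + 1 = (2 - α) + 1 by ring, Real.Gamma_add_one (by linarith)]
    have : 2 - α ≠ 0 := by linarith
    field_simp
  rw [hsplit, regCoeff_eq_T1 h0 h2]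
  apply mul_left_cancel₀ (mul_ne_zero two_ne_zero hs.ne')
  linear_combination 2 * (1 - α / 2) * hA0 + hT2 + n * hibp

lemma linIntegrand_neg (α : ℝ) (j : ℤ) (z : ℝ) :
    linIntegrand α (-j) z = linIntegrand α j (-z) := by
  simp [linIntegrand]

lemma continuous_linIntegrand_natCast {α : ℝ} (h2 : α < 2) (n : ℕ) :
    Continuous (linIntegrand α n) := by
  rw [funext (linIntegrand_natCast h2 n)]
  exact (Complex.continuous_ofReal.comp (continuous_linRe h2 n)).add
    (continuous_const.mul (Complex.continuous_ofReal.comp (continuous_linIm h2 n)))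

lemma integral_linIntegrand_natCast {α : ℝ} (h0 : 0 < α) (h2 : α < 2) (n : ℕ) :
    ∫ z in (-π)..π, linIntegrand α n z = ((-(2 * π) * (T1 α n - T2 α n
      - Real.Gamma (2 - α) / Real.Gamma (1 - α / 2) ^ 2) : ℝ) : ℂ) := by
  have c1 : Continuous fun z => (linRe α n z : ℂ) :=
    Complex.continuous_ofReal.comp (continuous_linRe h2 n)
  have c2 : Continuous fun z => Complex.I * (linIm α n z : ℂ) :=
    continuous_const.mul (Complex.continuous_ofReal.comp (continuous_linIm h2 n))
  simp only [linIntegrand_natCast h2 n]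
  rw [intervalIntegral.integral_add (c1.intervalIntegrable _ _) (c2.intervalIntegrable _ _),
    intervalIntegral.integral_const_mul, intervalIntegral.integral_ofReal,
    intervalIntegral.integral_ofReal, integral_linIm, integral_linRe h0 h2]
  simp

/-- Linearization of the pseudo-energy gradient at the disk (Lemma 3.1, Fourier form):
for `α ∈ (0,2)` and every `j ∈ ℤ`, the stated integrand is Lebesgue integrable on
`(−π,π)` and `(c_α/(2−α))·(1/2π)·∫_{−π}^{π} (…) dz = −L_α(|j|)`; i.e. the differential
of the pseudo-energy gradient at `f = 0` acts on the Fourier mode `e^{ijx}` with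
eigenvalue `−L_α(|j|)`. -/
theorem linearization_at_disk (α : ℝ) (hα : α ∈ Set.Ioo (0 : ℝ) 2) (j : ℤ) :
    IntervalIntegrable (linIntegrand α j) volume (-π) π ∧
    ((cAlpha α / (2 - α) : ℝ) : ℂ) * (1 / (2 * (π : ℂ))) *
        ∫ z in (-π)..π, linIntegrand α j z
      = ((-Lsymb α j.natAbs : ℝ) : ℂ) := by
  obtain ⟨h0, h2⟩ := hα
  have hcont : Continuous (linIntegrand α j) := by
    obtain ⟨n, rfl | rfl⟩ := j.eq_nat_or_neg
    · exact continuous_linIntegrand_natCast h2 n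
    · rw [funext (linIntegrand_neg α n)]
      exact (continuous_linIntegrand_natCast h2 n).comp continuous_neg
  have hintegral : ∫ z in (-π)..π, linIntegrand α j z = ((-(2 * π) * (T1 α j.natAbs - T2 α j.natAbs
      - Real.Gamma (2 - α) / Real.Gamma (1 - α / 2) ^ 2) : ℝ) : ℂ) := by
    obtain ⟨n, rfl | rfl⟩ := j.eq_nat_or_neg
    · exact integral_linIntegrand_natCast h0 h2 n
    · simp only [linIntegrand_neg α n, Int.natAbs_neg, Int.natAbs_natCast]
      rw [intervalIntegral.integral_comp_neg, neg_neg, integral_linIntegrand_natCast h0 h2]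
  refine ⟨hcont.intervalIntegrable _ _, ?_⟩
  rw [hintegral, Lsymb]
  have hpi : (π : ℂ) ≠ 0 := Complex.ofReal_ne_zero.2 Real.pi_ne_zero
  push_cast
  field_simp
end

section
/- First singular integral formula (Step 1 of Lemma 3.1). Let α ∈ (0,2). For every j ∈ ℤ, the function z ↦ (1 − e^{−ijz})·(2(1 − cos z))^{−α/2} (defined for z ∈ (−π,π)∖{0}) is Lebesgue integrable on (−π,π) and (1/2π)·∫_{−π}^{π} (1 − e^{−ijz})·(2(1 − cos z))^{−α/2} dz = T¹_α(|j|). -/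
open Real MeasureTheory

/-- `2 (1 - cos z)` is the square of `2 sin (z / 2)`. -/
lemma two_mul_one_sub_cos_eq_sq (z : ℝ) : 2 * (1 - cos z) = (2 * sin (z / 2)) ^ 2 := by
  have h := Real.cos_sq_add_sin_sq (z / 2)
  have h2 : cos z = 2 * cos (z / 2) ^ 2 - 1 := by
    rw [← Real.cos_two_mul]; congr 1; ring
  rw [h2]; linarith

lemma rpow_two_mul_one_sub_cos (α : ℝ) {z : ℝ} (hz : z ∈ Set.Icc 0 π) :
    (2 * (1 - cos z)) ^ (-(α / 2)) = (2 * sin (z / 2)) ^ (-α) := by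
  have h : 0 ≤ sin (z / 2) :=
    sin_nonneg_of_nonneg_of_le_pi (by linarith [hz.1]) (by linarith [hz.1, hz.2])
  rw [two_mul_one_sub_cos_eq_sq, ← Real.rpow_natCast, ← Real.rpow_mul (by positivity)]
  congr 1; push_cast; ring

/-- The singular integrand is dominated by a multiple of `z ^ (1 - α)` on `(0, π]`. -/
lemma norm_one_sub_exp_mul_rpow_le {α : ℝ} (hα : 0 < α) (j : ℤ) {z : ℝ}
    (hz : z ∈ Set.Ioc 0 π) :
    ‖(1 - Complex.exp (-Complex.I * j * z)) * (((2 * (1 - cos z)) ^ (-(α / 2)) : ℝ) : ℂ)‖ ≤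
      |(j : ℝ)| * (2 / π) ^ (-α) * z ^ (1 - α) := by
  have hz0 : 0 < z := hz.1
  have h1 : ‖1 - Complex.exp (-Complex.I * j * z)‖ ≤ |(j : ℝ)| * z := by
    have h := Real.norm_exp_I_mul_ofReal_sub_one_le (x := -((j : ℝ) * z))
    rw [norm_sub_rev]
    have he : Complex.I * ((-((j : ℝ) * z) : ℝ) : ℂ) = -Complex.I * j * z := by
      push_cast; ring
    rw [he] at h
    simpa [abs_mul, abs_of_pos hz0] using h
  have h2 : (2 * (1 - cos z)) ^ (-(α / 2)) ≤ (2 / π) ^ (-α) * z ^ (-α) := by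
    rw [rpow_two_mul_one_sub_cos α (Set.Ioc_subset_Icc_self hz),
      ← Real.mul_rpow (by positivity) hz0.le]
    have := Real.mul_le_sin (x := z / 2) (by linarith) (by linarith [hz.2])
    exact Real.rpow_le_rpow_of_nonpos (by positivity) (by linarith) (by linarith)
  have h3 : 0 ≤ (2 * (1 - cos z)) ^ (-(α / 2)) :=
    Real.rpow_nonneg (by linarith [Real.cos_le_one z]) _
  rw [norm_mul, Complex.norm_real, Real.norm_of_nonneg h3]
  calc _ ≤ (|(j : ℝ)| * z) * ((2 / π) ^ (-α) * z ^ (-α)) := by gcongr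
    _ = _ := by
      rw [sub_eq_add_neg, Real.rpow_add hz0, Real.rpow_one]; ring

lemma intervalIntegrable_one_sub_exp_mul_rpow {α : ℝ} (hα : α ∈ Set.Ioo (0 : ℝ) 2) (j : ℤ) :
    IntervalIntegrable
      (fun z : ℝ => (1 - Complex.exp (-Complex.I * j * z)) *
        (((2 * (1 - cos z)) ^ (-(α / 2)) : ℝ) : ℂ)) volume 0 π := by
  have h : IntervalIntegrable (fun z : ℝ => |(j : ℝ)| * (2 / π) ^ (-α) * z ^ (1 - α))
      volume 0 π :=
    (intervalIntegral.intervalIntegrable_rpow' (by linarith [hα.2])).const_mul _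
  refine h.mono_fun' (Measurable.aestronglyMeasurable (by fun_prop)) ?_
  rw [Set.uIoc_of_le pi_pos.le]
  filter_upwards [ae_restrict_mem measurableSet_Ioc] with z hz
  exact norm_one_sub_exp_mul_rpow_le hα.1 j hz

lemma one_sub_exp_mul_rpow_neg (α : ℝ) (j : ℤ) (z : ℝ) :
    (1 - Complex.exp (-Complex.I * j * (-z : ℝ))) *
        (((2 * (1 - cos (-z))) ^ (-(α / 2)) : ℝ) : ℂ) =
      (1 - Complex.exp (-Complex.I * (-j : ℤ) * z)) *
        (((2 * (1 - cos z)) ^ (-(α / 2)) : ℝ) : ℂ) := by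
  have h : -Complex.I * j * ((-z : ℝ) : ℂ) = -Complex.I * (-j : ℤ) * z := by
    push_cast; ring
  rw [Real.cos_neg, h]

lemma intervalIntegrable_one_sub_exp_mul_rpow_left {α : ℝ} (hα : α ∈ Set.Ioo (0 : ℝ) 2)
    (j : ℤ) :
    IntervalIntegrable
      (fun z : ℝ => (1 - Complex.exp (-Complex.I * j * z)) *
        (((2 * (1 - cos z)) ^ (-(α / 2)) : ℝ) : ℂ)) volume (-π) 0 := by
  rw [IntervalIntegrable.iff_comp_neg]
  simp_rw [one_sub_exp_mul_rpow_neg]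
  rw [neg_neg, neg_zero]
  exact (intervalIntegrable_one_sub_exp_mul_rpow hα (-j)).symm

lemma one_sub_exp_add_one_sub_exp (j : ℤ) (z : ℝ) :
    (1 - Complex.exp (-Complex.I * j * z)) + (1 - Complex.exp (-Complex.I * (-j : ℤ) * z)) =
      ((2 * (1 - cos (j.natAbs * z)) : ℝ) : ℂ) := by
  have h : cos (j.natAbs * z) = cos (j * z) := by
    rcases Int.natAbs_eq j with h | h
    · rw [congrArg (Int.cast (R := ℝ)) h]; simp
    · rw [congrArg (Int.cast (R := ℝ)) h]; simp
  rw [h]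
  push_cast
  rw [Complex.cos]
  have h1 : -Complex.I * j * z = -((j : ℂ) * z) * Complex.I := by ring
  have h2 : -Complex.I * -(j : ℂ) * z = ((j : ℂ) * z) * Complex.I := by ring
  rw [h1, h2]; ring

lemma intervalIntegrable_one_sub_cos_mul_rpow {α : ℝ} (hα : α ∈ Set.Ioo (0 : ℝ) 2) (n : ℕ) :
    IntervalIntegrable (fun z : ℝ => (1 - cos (n * z)) * (2 * (1 - cos z)) ^ (-(α / 2)))
      volume 0 π := by
  have h := (intervalIntegrable_one_sub_exp_mul_rpow hα n).add
    (intervalIntegrable_one_sub_exp_mul_rpow hα (-n))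
  rw [intervalIntegrable_iff] at h ⊢
  refine IntegrableOn.congr_fun (h.re.const_mul (1 / 2)) (fun z _ => ?_) measurableSet_uIoc
  rw [← add_mul, one_sub_exp_add_one_sub_exp, ← Complex.ofReal_mul,
    RCLike.re_to_complex, Complex.ofReal_re, Int.natAbs_natCast]
  ring

/-- Symmetrization: only the even part of the integrand contributes. -/
lemma integral_one_sub_exp_mul_rpow {α : ℝ} (hα : α ∈ Set.Ioo (0 : ℝ) 2) (j : ℤ) :
    ∫ z in (-π)..π, (1 - Complex.exp (-Complex.I * j * z)) *
        (((2 * (1 - cos z)) ^ (-(α / 2)) : ℝ) : ℂ) =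
      ((2 * ∫ z in (0 : ℝ)..π, (1 - cos (j.natAbs * z)) *
        (2 * (1 - cos z)) ^ (-(α / 2)) : ℝ) : ℂ) := by
  have hr := intervalIntegrable_one_sub_exp_mul_rpow hα j
  rw [← intervalIntegral.integral_add_adjacent_intervals
    (intervalIntegrable_one_sub_exp_mul_rpow_left hα j) hr]
  have hl := intervalIntegral.integral_comp_neg (a := 0) (b := π)
    (fun z : ℝ => (1 - Complex.exp (-Complex.I * j * z)) *
        (((2 * (1 - cos z)) ^ (-(α / 2)) : ℝ) : ℂ))
  simp_rw [one_sub_exp_mul_rpow_neg] at hl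
  rw [neg_zero] at hl
  rw [← hl, add_comm, ← intervalIntegral.integral_add hr
    (intervalIntegrable_one_sub_exp_mul_rpow hα (-j)), ← intervalIntegral.integral_const_mul,
    ← intervalIntegral.integral_ofReal]
  congr 1
  ext z
  rw [← add_mul, one_sub_exp_add_one_sub_exp, ← Complex.ofReal_mul, mul_assoc]

lemma intervalIntegrable_sin_rpow {s : ℝ} (hs : -1 < s) :
    IntervalIntegrable (fun u : ℝ => sin u ^ s) volume 0 (π / 2) := by
  have hi := intervalIntegral.intervalIntegrable_rpow' (a := 0) (b := π / 2) hs
  have h : IntervalIntegrable (fun u : ℝ => u ^ s + (2 / π) ^ s * u ^ s) volume 0 (π / 2) :=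
    hi.add (hi.const_mul _)
  refine h.mono_fun' (Measurable.aestronglyMeasurable (by fun_prop)) ?_
  rw [Set.uIoc_of_le (by positivity)]
  filter_upwards [ae_restrict_mem measurableSet_Ioc] with u hu
  have hu0 : 0 < u := hu.1
  have hl := Real.mul_le_sin hu0.le hu.2
  have hp : 0 < 2 / π * u := by positivity
  rw [Real.norm_of_nonneg (Real.rpow_nonneg (hp.le.trans hl) _),
    ← Real.mul_rpow (by positivity) hu0.le]
  rcases le_total 0 s with h0 | h0
  · exact (Real.rpow_le_rpow (hp.le.trans hl) (Real.sin_le hu0.le) h0).trans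
      (le_add_of_nonneg_right (by positivity))
  · exact (Real.rpow_le_rpow_of_nonpos hp hl h0).trans (le_add_of_nonneg_left (by positivity))

lemma intervalIntegrable_sin_mul_sin_rpow {s : ℝ} (hs : -1 < s) (c : ℝ) :
    IntervalIntegrable (fun u : ℝ => sin (c * u) * sin u ^ s) volume 0 (π / 2) :=
  (intervalIntegrable_sin_rpow hs).continuousOn_mul (by fun_prop)

/-- Integration by parts recurrence for the sine moments of `sin ^ s`. -/
lemma integral_sin_mul_sin_rpow_succ {s : ℝ} (hs : -1 < s) (n : ℕ) :
    (2 * n + 3 + s) * ∫ u in (0 : ℝ)..π / 2, sin ((2 * (n + 1 : ℕ) + 1) * u) * sin u ^ s =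
      (2 * n + 1 - s) * ∫ u in (0 : ℝ)..π / 2, sin ((2 * n + 1) * u) * sin u ^ s := by
  have hi1 := (intervalIntegrable_sin_mul_sin_rpow hs (2 * (n + 1 : ℕ) + 1)).const_mul
    ((2 * n + 3 + s) / 2)
  have hi0 := (intervalIntegrable_sin_mul_sin_rpow hs (2 * n + 1)).const_mul
    ((2 * n + 1 - s) / 2)
  have key := intervalIntegral.integral_eq_sub_of_hasDerivAt_of_le (a := 0) (b := π / 2)
    (f := fun u => sin u ^ (s + 1) * sin ((2 * n + 2) * u)) (by positivity)
    ?_ ?_ (hi1.sub hi0)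
  · rw [intervalIntegral.integral_sub hi1 hi0, intervalIntegral.integral_const_mul,
      intervalIntegral.integral_const_mul] at key
    have hb : sin ((2 * n + 2) * (π / 2)) = 0 := by
      rw [← Real.sin_nat_mul_pi (n + 1)]; congr 1; push_cast; ring
    rw [hb] at key
    simp only [mul_zero, Real.sin_zero, sub_zero] at key
    linarith
  · exact ((Real.continuous_sin.rpow_const fun _ => Or.inr (by linarith)).mul
      (by fun_prop)).continuousOn
  · intro u hu
    have hsin : 0 < sin u := sin_pos_of_pos_of_lt_pi hu.1 (by linarith [hu.2, pi_pos])
    have h1 : HasDerivAt (fun u => sin u ^ (s + 1)) (cos u * (s + 1) * sin u ^ (s + 1 - 1)) u :=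
      (Real.hasDerivAt_sin u).rpow_const (Or.inl hsin.ne')
    have h2 : HasDerivAt (fun u => sin ((2 * n + 2) * u))
        (cos ((2 * n + 2) * u) * (2 * n + 2)) u := by
      simpa using ((hasDerivAt_id u).const_mul (2 * n + 2 : ℝ)).sin
    refine (h1.mul h2).congr_deriv ?_
    rw [add_sub_cancel_right, Real.rpow_add hsin, Real.rpow_one]
    have e1 : (2 * ((n + 1 : ℕ) : ℝ) + 1) * u = (2 * n + 2) * u + u := by push_cast; ring
    have e2 : (2 * (n : ℝ) + 1) * u = (2 * n + 2) * u - u := by ring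
    rw [e1, e2, Real.sin_add, Real.sin_sub]
    ring

lemma integral_sin_rpow_eq_beta {s : ℝ} (hs : -1 < s) :
    2 * ∫ u in (0 : ℝ)..π / 2, sin u ^ s = ProbabilityTheory.beta ((s + 1) / 2) (1 / 2) := by
  have hβ : ProbabilityTheory.beta ((s + 1) / 2) (1 / 2) =
      ∫ x in (0 : ℝ)..1, x ^ ((s + 1) / 2 - 1) * (1 - x) ^ ((1 / 2 : ℝ) - 1) := by
    rw [ProbabilityTheory.beta_eq_betaIntegralReal _ _ (by linarith) (by norm_num),
      ← Complex.ofReal_re (∫ x in (0 : ℝ)..1, _), ← intervalIntegral.integral_ofReal,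
      Complex.betaIntegral]
    congr 1
    refine intervalIntegral.integral_congr fun x hx => ?_
    rw [Set.uIcc_of_le zero_le_one] at hx
    rw [Complex.ofReal_mul, Complex.ofReal_cpow hx.1, Complex.ofReal_cpow (by linarith [hx.2])]
    push_cast
    rfl
  have hsub := intervalIntegral.integral_comp_mul_deriv_of_deriv_nonneg (a := 0) (b := π / 2)
    (f := fun u => sin u ^ 2) (f' := fun u => 2 * sin u * cos u)
    (g := fun x => x ^ ((s + 1) / 2 - 1) * (1 - x) ^ ((1 / 2 : ℝ) - 1))
    (by fun_prop) ?_ ?_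
  · simp only [Real.sin_zero, Real.sin_pi_div_two, one_pow, ne_eq, OfNat.ofNat_ne_zero,
      not_false_eq_true, zero_pow] at hsub
    rw [hβ, ← hsub, ← intervalIntegral.integral_const_mul]
    refine intervalIntegral.integral_congr_Ioo_of_le (by positivity) fun u hu => ?_
    have hsin : 0 < sin u := sin_pos_of_pos_of_lt_pi hu.1 (by linarith [hu.2, pi_pos])
    have hcos : 0 < cos u := cos_pos_of_mem_Ioo ⟨by linarith [hu.1, pi_pos], hu.2⟩
    have h1 : 1 - sin u ^ 2 = cos u ^ 2 := by linarith [Real.sin_sq_add_cos_sq u]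
    simp only [Function.comp]
    rw [h1, ← Real.rpow_natCast, ← Real.rpow_natCast, ← Real.rpow_mul hsin.le,
      ← Real.rpow_mul hcos.le]
    have e1 : ((2 : ℕ) : ℝ) * ((s + 1) / 2 - 1) = s - 1 := by push_cast; ring
    have e2 : ((2 : ℕ) : ℝ) * ((1 / 2 : ℝ) - 1) = -1 := by norm_num
    rw [e1, e2, Real.rpow_sub_one hsin.ne', Real.rpow_neg_one]
    field_simp
  · intro u _
    simpa using (Real.hasDerivAt_sin u).fun_pow 2
  · intro u hu
    rw [min_eq_left (by positivity), max_eq_right (by positivity)] at hu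
    have hsin : 0 < sin u := sin_pos_of_pos_of_lt_pi hu.1 (by linarith [hu.2, pi_pos])
    have hcos : 0 < cos u := cos_pos_of_mem_Ioo ⟨by linarith [hu.1, pi_pos], hu.2⟩
    positivity

lemma integral_sin_mul_sin_rpow {α : ℝ} (hα : α ∈ Set.Ioo (0 : ℝ) 2) (n : ℕ) :
    2 * (2 : ℝ) ^ (1 - α) *
        ∫ u in (0 : ℝ)..π / 2, sin ((2 * n + 1) * u) * sin u ^ (1 - α) =
      π * (Gamma (2 - α) / (Gamma (1 - α / 2) * Gamma (α / 2))) *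
        (Gamma (α / 2 + n) / Gamma (2 - α / 2 + n)) := by
  obtain ⟨h0, h2⟩ := hα
  have hΓ1 : Gamma (α / 2) ≠ 0 := (Gamma_pos_of_pos (by linarith)).ne'
  have hΓ2 : Gamma (1 - α / 2) ≠ 0 := (Gamma_pos_of_pos (by linarith)).ne'
  have hΓ3 : Gamma (2 - α / 2) ≠ 0 := (Gamma_pos_of_pos (by linarith)).ne'
  induction n with
  | zero =>
    have hI : ∫ u in (0 : ℝ)..π / 2, sin ((2 * (0 : ℕ) + 1) * u) * sin u ^ (1 - α) =
        ∫ u in (0 : ℝ)..π / 2, sin u ^ (2 - α) := by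
      refine intervalIntegral.integral_congr_Ioo_of_le (by positivity) fun u hu => ?_
      have hsin : 0 < sin u := sin_pos_of_pos_of_lt_pi hu.1 (by linarith [hu.2, pi_pos])
      have e : 2 - α = 1 + (1 - α) := by ring
      simp only [Nat.cast_zero, mul_zero, zero_add, one_mul]
      rw [e, Real.rpow_add hsin, Real.rpow_one]
    have hB := integral_sin_rpow_eq_beta (s := 2 - α) (by linarith)
    have hD := Real.Gamma_mul_Gamma_add_half (1 - α / 2)
    have hπ := Real.mul_self_sqrt pi_pos.le
    have hp : (2 : ℝ) ^ (1 - α) * 2 ^ (1 - 2 * (1 - α / 2)) = 1 := by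
      rw [← Real.rpow_add two_pos]; ring_nf; simp
    have a1 : 2 * (1 - α / 2) = 2 - α := by ring
    have a2 : 1 - α / 2 + 1 / 2 = (2 - α + 1) / 2 := by ring
    have a3 : (2 - α + 1) / 2 + 1 / 2 = 2 - α / 2 := by ring
    rw [a1] at hp
    rw [ProbabilityTheory.beta, Real.Gamma_one_half_eq, a3] at hB
    rw [a1, a2] at hD
    rw [hI, mul_right_comm, hB]
    simp only [Nat.cast_zero, add_zero]
    rw [div_mul_eq_mul_div, mul_div_assoc', div_left_inj' hΓ3, mul_div_assoc',
      div_mul_eq_mul_div, eq_div_iff (mul_ne_zero hΓ2 hΓ1)]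
    calc _ =
          (Gamma (1 - α / 2) * Gamma ((2 - α + 1) / 2)) * √π * 2 ^ (1 - α) * Gamma (α / 2) := by ring
      _ = Gamma (2 - α) * (√π * √π) * (2 ^ (1 - α) * 2 ^ (1 - (2 - α))) * Gamma (α / 2) := by rw [hD]; ring
      _ = _ := by rw [hπ, hp]; ring
  | succ n ih =>
    have hrec := integral_sin_mul_sin_rpow_succ (s := 1 - α) (by linarith) n
    have hn : (0 : ℝ) ≤ n := n.cast_nonneg
    have g1 : Gamma (α / 2 + (n + 1 : ℕ)) = (α / 2 + n) * Gamma (α / 2 + n) := by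
      rw [← Real.Gamma_add_one (by positivity)]; push_cast; ring_nf
    have g2 : Gamma (2 - α / 2 + (n + 1 : ℕ)) = (2 - α / 2 + n) * Gamma (2 - α / 2 + n) := by
      rw [← Real.Gamma_add_one (by linarith)]; push_cast; ring_nf
    have hc : (2 - α / 2 + n : ℝ) ≠ 0 := by linarith
    rw [g1, g2]
    have hrec' : ∫ u in (0 : ℝ)..π / 2, sin ((2 * (n + 1 : ℕ) + 1) * u) * sin u ^ (1 - α) =
        (α / 2 + n) / (2 - α / 2 + n) *
          ∫ u in (0 : ℝ)..π / 2, sin ((2 * n + 1) * u) * sin u ^ (1 - α) := by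
      rw [div_mul_eq_mul_div, eq_div_iff hc]
      linarith
    rw [hrec', mul_left_comm, ih, mul_div_mul_comm]
    ring

lemma integral_one_sub_cos_mul_rpow_succ_sub {α : ℝ} (hα : α ∈ Set.Ioo (0 : ℝ) 2) (n : ℕ) :
    (∫ z in (0 : ℝ)..π, (1 - cos ((n + 1 : ℕ) * z)) * (2 * (1 - cos z)) ^ (-(α / 2))) -
        ∫ z in (0 : ℝ)..π, (1 - cos (n * z)) * (2 * (1 - cos z)) ^ (-(α / 2)) =
      2 * (2 : ℝ) ^ (1 - α) *
        ∫ u in (0 : ℝ)..π / 2, sin ((2 * n + 1) * u) * sin u ^ (1 - α) := by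
  rw [← intervalIntegral.integral_sub (intervalIntegrable_one_sub_cos_mul_rpow hα (n + 1))
    (intervalIntegrable_one_sub_cos_mul_rpow hα n)]
  have hsub := intervalIntegral.integral_comp_div (a := 0) (b := π)
    (fun u => sin ((2 * n + 1) * u) * sin u ^ (1 - α)) (two_ne_zero (α := ℝ))
  rw [zero_div, smul_eq_mul] at hsub
  rw [mul_right_comm, ← hsub, mul_comm, ← intervalIntegral.integral_const_mul]
  refine intervalIntegral.integral_congr_Ioo_of_le pi_pos.le fun z hz => ?_
  have hsin : 0 < sin (z / 2) :=
    sin_pos_of_pos_of_lt_pi (by linarith [hz.1]) (by linarith [hz.1, hz.2])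
  rw [rpow_two_mul_one_sub_cos α (Set.Ioo_subset_Icc_self hz)]
  have e : sin (z / 2) ^ (1 - α) * 2 ^ (1 - α) = 2 * sin (z / 2) * (2 * sin (z / 2)) ^ (-α) := by
    rw [mul_comm, ← Real.mul_rpow two_pos.le hsin.le, sub_eq_add_neg,
      Real.rpow_add (by positivity), Real.rpow_one]
  have e1 : ((n + 1 : ℕ) : ℝ) * z = (2 * n + 1) * (z / 2) + z / 2 := by push_cast; ring
  have e2 : (n : ℝ) * z = (2 * n + 1) * (z / 2) - z / 2 := by ring
  rw [e1, e2, Real.cos_add, Real.cos_sub]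
  linear_combination (-sin ((2 * n + 1) * (z / 2))) * e

lemma integral_one_sub_cos_mul_rpow {α : ℝ} (hα : α ∈ Set.Ioo (0 : ℝ) 2) (n : ℕ) :
    ∫ z in (0 : ℝ)..π, (1 - cos (n * z)) * (2 * (1 - cos z)) ^ (-(α / 2)) = π * T1 α n := by
  induction n with
  | zero => simp [T1]
  | succ n ih =>
    have h := integral_one_sub_cos_mul_rpow_succ_sub hα n
    have hn : (0 : ℝ) ≤ n := n.cast_nonneg
    have g : Gamma (2 - α / 2 + n) = (1 - α / 2 + n) * Gamma (1 - α / 2 + n) := by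
      rw [← Real.Gamma_add_one (by linarith [hα.2])]; ring_nf
    rw [integral_sin_mul_sin_rpow hα, ih, g] at h
    rw [T1] at h ⊢
    rw [Finset.sum_range_succ]
    linear_combination h

/-- First singular integral formula (Step 1 of Lemma 3.1): for `α ∈ (0,2)` and `j ∈ ℤ`,
`(1/2π)·∫_{−π}^{π} (1 − e^{−ijz})·(2(1 − cos z))^{−α/2} dz = T¹_α(|j|)`, the integrand
being Lebesgue integrable on `(−π,π)`. -/
theorem first_singular_integral (α : ℝ) (hα : α ∈ Set.Ioo (0 : ℝ) 2) (j : ℤ) :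
    IntervalIntegrable
        (fun z : ℝ => (1 - Complex.exp (-Complex.I * j * z)) *
          (((2 * (1 - Real.cos z)) ^ (-(α / 2)) : ℝ) : ℂ))
        volume (-π) π ∧
    (1 / (2 * (π : ℂ))) *
        ∫ z in (-π)..π, (1 - Complex.exp (-Complex.I * j * z)) *
          (((2 * (1 - Real.cos z)) ^ (-(α / 2)) : ℝ) : ℂ)
      = (T1 α j.natAbs : ℝ) := by
  refine ⟨(intervalIntegrable_one_sub_exp_mul_rpow_left hα j).trans
    (intervalIntegrable_one_sub_exp_mul_rpow hα j), ?_⟩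
  have hπ : (π : ℂ) ≠ 0 := Complex.ofReal_ne_zero.mpr pi_ne_zero
  rw [integral_one_sub_exp_mul_rpow hα, integral_one_sub_cos_mul_rpow hα]
  push_cast
  field_simp
end

section
/- Closed form of the Gamma sum (Remark 3.3). Let α ∈ (0,2) with α ≠ 1. For every integer n ≥ 0, Σ_{k=0}^{n−1} Γ(α/2+k)/((1−α/2+k)·Γ(1−α/2+k)) = (1/(α−1))·( Γ(α/2+n)/Γ(1+n−α/2) − Γ(α/2)/Γ(1−α/2) ), where Γ denotes the real Gamma function (and the empty sum for n = 0 is 0). -/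
open Real

/-- Closed form of the Gamma sum (Remark 3.3): for `α ∈ (0,2)`, `α ≠ 1`, and every `n ≥ 0`,
`Σ_{k=0}^{n−1} Γ(α/2+k)/((1−α/2+k)·Γ(1−α/2+k))
  = (1/(α−1))·(Γ(α/2+n)/Γ(1+n−α/2) − Γ(α/2)/Γ(1−α/2))`. -/
theorem gamma_sum_closed_form (α : ℝ) (hα : α ∈ Set.Ioo (0 : ℝ) 2) (hα1 : α ≠ 1) (n : ℕ) :
    ∑ k ∈ Finset.range n,
        Real.Gamma (α / 2 + k) / ((1 - α / 2 + k) * Real.Gamma (1 - α / 2 + k))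
      = (1 / (α - 1)) *
          (Real.Gamma (α / 2 + n) / Real.Gamma (1 + n - α / 2)
            - Real.Gamma (α / 2) / Real.Gamma (1 - α / 2)) := by
  obtain ⟨h0, h2⟩ := hα
  have hne : α - 1 ≠ 0 := sub_ne_zero.mpr hα1
  induction n with
  | zero => simp
  | succ n ih =>
    have hn : (0 : ℝ) ≤ n := n.cast_nonneg
    have hx : 0 < α / 2 + n := by linarith
    have hy : 0 < 1 - α / 2 + n := by linarith
    have hΓ : Real.Gamma (1 - α / 2 + n) ≠ 0 := (Real.Gamma_pos_of_pos hy).ne'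
    have hnum : Real.Gamma (α / 2 + (n + 1 : ℕ)) = (α / 2 + n) * Real.Gamma (α / 2 + n) := by
      rw [← Real.Gamma_add_one hx.ne']
      push_cast
      ring_nf
    have hden : Real.Gamma (1 + (n + 1 : ℕ) - α / 2)
        = (1 - α / 2 + n) * Real.Gamma (1 - α / 2 + n) := by
      rw [← Real.Gamma_add_one hy.ne']
      push_cast
      ring_nf
    have hstep : Real.Gamma (α / 2 + n) / ((1 - α / 2 + n) * Real.Gamma (1 - α / 2 + n))
        = (1 / (α - 1)) * ((α / 2 + n) * Real.Gamma (α / 2 + n)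
            / ((1 - α / 2 + n) * Real.Gamma (1 - α / 2 + n))
          - Real.Gamma (α / 2 + n) / Real.Gamma (1 - α / 2 + n)) := by
      rw [← mul_div_mul_left (Real.Gamma (α / 2 + n)) (Real.Gamma (1 - α / 2 + n)) hy.ne',
        ← sub_div, ← sub_mul, show α / 2 + n - (1 - α / 2 + n) = α - 1 by ring,
        mul_div_assoc, ← mul_assoc, one_div_mul_cancel hne, one_mul]
    rw [Finset.sum_range_succ, ih, hnum, hden, hstep,
      show 1 + (n : ℝ) - α / 2 = 1 - α / 2 + n by ring]
    ring
end

section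
/- Convexity of the linear frequencies (Lemma 3.3). Let α ∈ (0,2). For every integer j ≥ 1 the second difference of the frequency map satisfies ω_α(j+1) + ω_α(j−1) − 2·ω_α(j) = ( Γ(2−α)/(2^{1−α}·Γ(1−α/2)²) )·( Γ(α/2−1+j)/Γ(2−α/2+j) )·α·j, and this quantity is strictly positive. -/
open Real

/-- The first difference of the symbol `L_α`. -/
lemma Lsymb_succ_sub {α : ℝ} (h0 : 0 < α) (h2 : α < 2) (n : ℕ) :
    Lsymb α (n + 1) - Lsymb α n
      = Gamma (2 - α) / (2 ^ (1 - α) * Gamma (1 - α / 2) ^ 2) *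
          (Gamma (α / 2 + n) / ((1 - α / 2 + n) * Gamma (1 - α / 2 + n))) := by
  have hn : (0 : ℝ) ≤ n := Nat.cast_nonneg n
  have hb : 0 < 1 - α / 2 + (n : ℝ) := by linarith
  have ha : 0 < α / 2 + (n : ℝ) := by linarith
  have gb : 0 < Gamma (1 - α / 2) := Gamma_pos_of_pos (by linarith)
  have ga : 0 < Gamma (α / 2) := Gamma_pos_of_pos (by linarith)
  have gbn : 0 < Gamma (1 - α / 2 + n) := Gamma_pos_of_pos hb
  have hp : (0 : ℝ) < 2 ^ (1 - α) := rpow_pos_of_pos (by norm_num) _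
  have ea : Gamma (α / 2 + ((n + 1 : ℕ) : ℝ)) = (α / 2 + n) * Gamma (α / 2 + n) := by
    rw [← Gamma_add_one ha.ne']; congr 1; push_cast; ring
  have eb : Gamma (1 - α / 2 + ((n + 1 : ℕ) : ℝ))
      = (1 - α / 2 + n) * Gamma (1 - α / 2 + n) := by
    rw [← Gamma_add_one hb.ne']; congr 1; push_cast; ring
  unfold Lsymb T1 T2 cAlpha
  rw [Finset.sum_range_succ, ea, eb]
  have h2' : 2 - α ≠ 0 := by linarith
  generalize Gamma (1 - α / 2 + n) = y at *
  generalize Gamma (α / 2 + n) = x at *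
  generalize Gamma (1 - α / 2) = u at *
  generalize Gamma (α / 2) = v at *
  generalize Gamma (2 - α) = w at *
  generalize (2 : ℝ) ^ (1 - α) = p at *
  generalize ∑ k ∈ Finset.range n, Gamma (α / 2 + k) /
    ((1 - α / 2 + k) * Gamma (1 - α / 2 + k)) = S at *
  generalize hB : 1 - α / 2 + (n : ℝ) = B at *
  obtain rfl : α = 2 * (1 + n - B) := by linarith
  have hBn : B - (n : ℝ) ≠ 0 := fun h => h2' (by linarith)
  rw [show 2 - 2 * (1 + (n : ℝ) - B) = 2 * (B - n) by ring]
  field_simp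
  ring

/-- Convexity of the linear frequencies (Lemma 3.3): for every integer `j ≥ 1` the second
difference of the frequency map has the stated Gamma-quotient closed form and is
strictly positive. -/
theorem frequency_convexity (α : ℝ) (hα : α ∈ Set.Ioo (0 : ℝ) 2) (j : ℤ) (hj : 1 ≤ j) :
    omega α (j + 1) + omega α (j - 1) - 2 * omega α j
      = (Real.Gamma (2 - α) / (2 ^ (1 - α) * (Real.Gamma (1 - α / 2)) ^ 2)) *
          (Real.Gamma (α / 2 - 1 + j) / Real.Gamma (2 - α / 2 + j)) * α * j ∧
    0 < (Real.Gamma (2 - α) / (2 ^ (1 - α) * (Real.Gamma (1 - α / 2)) ^ 2)) *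
          (Real.Gamma (α / 2 - 1 + j) / Real.Gamma (2 - α / 2 + j)) * α * j := by
  obtain ⟨h0, h2⟩ := hα
  obtain ⟨m, rfl⟩ : ∃ m : ℕ, j = (m : ℤ) + 1 := ⟨(j - 1).toNat, by omega⟩
  have hm : (0 : ℝ) ≤ m := Nat.cast_nonneg m
  have hb : 0 < 1 - α / 2 + (m : ℝ) := by linarith
  have ha : 0 < α / 2 + (m : ℝ) := by linarith
  have gα : 0 < Gamma (2 - α) := Gamma_pos_of_pos (by linarith)
  have gb : 0 < Gamma (1 - α / 2) := Gamma_pos_of_pos (by linarith)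
  have gbm : 0 < Gamma (1 - α / 2 + m) := Gamma_pos_of_pos hb
  have gam : 0 < Gamma (α / 2 + m) := Gamma_pos_of_pos ha
  have hp : (0 : ℝ) < 2 ^ (1 - α) := rpow_pos_of_pos (by norm_num) _
  have e1 : Gamma (α / 2 - 1 + (((m : ℤ) + 1 : ℤ) : ℝ)) = Gamma (α / 2 + m) := by
    congr 1; push_cast; ring
  have e2 : Gamma (2 - α / 2 + (((m : ℤ) + 1 : ℤ) : ℝ))
      = (1 - α / 2 + m + 1) * ((1 - α / 2 + m) * Gamma (1 - α / 2 + m)) := by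
    rw [← Gamma_add_one hb.ne', ← Gamma_add_one (by linarith)]
    congr 1; push_cast; ring
  refine ⟨?_, ?_⟩
  · have hd₀ := Lsymb_succ_sub h0 h2 m
    have hd₁ := Lsymb_succ_sub h0 h2 (m + 1)
    have ea : Gamma (α / 2 + ((m + 1 : ℕ) : ℝ)) = (α / 2 + m) * Gamma (α / 2 + m) := by
      rw [← Gamma_add_one ha.ne']; congr 1; push_cast; ring
    have eb : Gamma (1 - α / 2 + ((m + 1 : ℕ) : ℝ))
        = (1 - α / 2 + m) * Gamma (1 - α / 2 + m) := by
      rw [← Gamma_add_one hb.ne']; congr 1; push_cast; ring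
    rw [ea, eb] at hd₁
    have n₂ : ((m : ℤ) + 1 + 1).natAbs = m + 1 + 1 := by omega
    have n₁ : ((m : ℤ) + 1).natAbs = m + 1 := by omega
    have n₀ : ((m : ℤ) + 1 - 1).natAbs = m := by omega
    rw [e1, e2]
    unfold omega
    rw [n₂, n₁, n₀]
    rw [sub_eq_iff_eq_add] at hd₀ hd₁
    rw [hd₁, hd₀]
    have hb' : 1 - α / 2 + (m : ℝ) + 1 ≠ 0 := by linarith
    push_cast
    rw [← add_assoc (1 - α / 2) (m : ℝ) 1]
    generalize Gamma (1 - α / 2 + m) = y at *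
    generalize Gamma (α / 2 + m) = x at *
    generalize hB : 1 - α / 2 + (m : ℝ) = B at *
    obtain rfl : α = 2 * (1 + m - B) := by linarith
    field_simp
    ring
  · rw [e1, e2]
    have hj' : (0 : ℝ) < (((m : ℤ) + 1 : ℤ) : ℝ) := by push_cast; linarith
    positivity
end

section
/- Positivity and monotonicity of the linear frequencies (Lemma 3.3, second part). Let α ∈ (0,2). Then ω_α(j) > 0 for every integer j ≥ 2, ω_α(j+1) > ω_α(j) for every integer j ≥ 2, and ω_α(j) ≠ 0 for every integer j with |j| ≥ 2. -/
open Real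

/-- The symbol `L_α` is strictly increasing on the natural numbers. -/
theorem Lsymb_lt_succ {α : ℝ} (hα : α ∈ Set.Ioo (0 : ℝ) 2) (n : ℕ) :
    Lsymb α n < Lsymb α (n + 1) := by
  obtain ⟨h0, h2⟩ := hα
  have hn : (0 : ℝ) ≤ n := n.cast_nonneg
  have ha : 0 < Real.Gamma (α / 2) := Real.Gamma_pos_of_pos (by linarith)
  have hb : 0 < Real.Gamma (1 - α / 2) := Real.Gamma_pos_of_pos (by linarith)
  have hc : 0 < Real.Gamma (2 - α) := Real.Gamma_pos_of_pos (by linarith)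
  have hA : 0 < Real.Gamma (α / 2 + n) := Real.Gamma_pos_of_pos (by linarith)
  have hB : 0 < Real.Gamma (1 - α / 2 + n) := Real.Gamma_pos_of_pos (by linarith)
  have hs : 0 < 1 - α / 2 + n := by linarith
  have hd : 0 < 2 - α := by linarith
  have hA' : Real.Gamma (α / 2 + (n + 1 : ℕ)) = (α / 2 + n) * Real.Gamma (α / 2 + n) := by
    rw [← Real.Gamma_add_one (by linarith)]
    push_cast
    ring_nf
  have hB' : Real.Gamma (1 - α / 2 + (n + 1 : ℕ)) =
      (1 - α / 2 + n) * Real.Gamma (1 - α / 2 + n) := by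
    rw [← Real.Gamma_add_one (by linarith)]
    push_cast
    ring_nf
  have hK : 0 < cAlpha α / (2 - α) := by
    unfold cAlpha
    positivity
  unfold Lsymb
  refine mul_lt_mul_of_pos_left ?_ hK
  refine sub_lt_sub_right (sub_pos.mp ?_) _
  have key : T1 α (n + 1) - T2 α (n + 1) - (T1 α n - T2 α n) =
      (Real.Gamma (2 - α) / (Real.Gamma (1 - α / 2) * Real.Gamma (α / 2))) *
        ((2 - α) * Real.Gamma (α / 2 + n) /
          ((1 - α / 2 + n) * Real.Gamma (1 - α / 2 + n))) := by
    have h : Real.Gamma (α / 2 + n) / Real.Gamma (1 - α / 2 + n) =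
        (1 - α / 2 + n) * (Real.Gamma (α / 2 + n) /
          ((1 - α / 2 + n) * Real.Gamma (1 - α / 2 + n))) := by
      field_simp
    unfold T1 T2
    rw [Finset.sum_range_succ, hA', hB', h]
    ring
  rw [key]
  positivity

/-- The symbol `L_α` vanishes at `1`. -/
theorem Lsymb_one {α : ℝ} (hα : α ∈ Set.Ioo (0 : ℝ) 2) : Lsymb α 1 = 0 := by
  obtain ⟨h0, h2⟩ := hα
  have ha : Real.Gamma (α / 2) ≠ 0 := (Real.Gamma_pos_of_pos (by linarith)).ne'
  have hb : Real.Gamma (1 - α / 2) ≠ 0 := (Real.Gamma_pos_of_pos (by linarith)).ne'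
  have hs : 1 - α / 2 ≠ 0 := by linarith
  have hA : Real.Gamma (α / 2 + 1) = α / 2 * Real.Gamma (α / 2) :=
    Real.Gamma_add_one (by linarith)
  have hB : Real.Gamma (1 - α / 2 + 1) = (1 - α / 2) * Real.Gamma (1 - α / 2) :=
    Real.Gamma_add_one hs
  unfold Lsymb T1 T2
  refine mul_eq_zero_of_right _ ?_
  simp only [Finset.sum_range_one, Nat.cast_zero, Nat.cast_one, add_zero, hA, hB]
  generalize Real.Gamma (α / 2) = x at *
  generalize Real.Gamma (1 - α / 2) = y at *
  obtain ⟨s, hs'⟩ : ∃ s, s = 1 - α / 2 := ⟨_, rfl⟩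
  rw [← hs'] at hs ⊢
  rw [show α / 2 = 1 - s by linarith]
  field_simp
  ring

theorem Lsymb_pos {α : ℝ} (hα : α ∈ Set.Ioo (0 : ℝ) 2) {n : ℕ} (hn : 2 ≤ n) :
    0 < Lsymb α n := by
  rw [← Lsymb_one hα]
  exact strictMono_nat_of_lt_succ (Lsymb_lt_succ hα) hn

/-- Positivity and monotonicity of the linear frequencies (Lemma 3.3, second part):
`ω_α(j) > 0` and `ω_α` is increasing for integers `j ≥ 2`, and `ω_α(j) ≠ 0` for `|j| ≥ 2`. -/
theorem frequency_positivity (α : ℝ) (hα : α ∈ Set.Ioo (0 : ℝ) 2) :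
    (∀ j : ℤ, 2 ≤ j → 0 < omega α j) ∧
    (∀ j : ℤ, 2 ≤ j → omega α j < omega α (j + 1)) ∧
    (∀ j : ℤ, 2 ≤ |j| → omega α j ≠ 0) := by
  refine ⟨fun j hj => ?_, fun j hj => ?_, fun j hj => ?_⟩
  · have hj' : (0 : ℝ) < j := by exact_mod_cast (by omega : 0 < j)
    exact mul_pos hj' (Lsymb_pos hα (by omega))
  · have hj' : (0 : ℝ) < j := by exact_mod_cast (by omega : 0 < j)
    unfold omega
    rw [show (j + 1).natAbs = j.natAbs + 1 by omega]
    refine mul_lt_mul'' ?_ (Lsymb_lt_succ hα _) hj'.le (Lsymb_pos hα (by omega)).le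
    push_cast
    linarith
  · have hj' : (j : ℝ) ≠ 0 := by
      rintro h
      simp [Int.cast_eq_zero.mp h] at hj
    have hn : 2 ≤ j.natAbs := by
      rw [Int.abs_eq_natAbs] at hj
      exact_mod_cast hj
    exact mul_ne_zero hj' (Lsymb_pos hα hn).ne'
end

section
/- Derivative bounds for Gamma ratios (equation (3.22) in the proof of Lemma 3.1). Let a, b ∈ ℝ. For every integer μ ≥ 1 there exist constants C > 0 and R > 0 such that for every real ξ ≥ R the function g(ξ) := Γ(ξ + a)/Γ(ξ + b) is μ-times differentiable at ξ and |g^{(μ)}(ξ)| ≤ C·ξ^{a−b−μ}, where Γ denotes the Gamma function. -/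
open Real

open Set MeasureTheory Metric Filter Topology

theorem Complex.norm_betaIntegral_ofReal_le {c : ℝ} (hc : 0 < c) {z : ℂ} (hz : 1 < z.re) :
    ‖Complex.betaIntegral c z‖ ≤ (1 / (z.re - 1)) ^ c * Real.Gamma c := by
  have hr : 0 < z.re - 1 := by linarith
  have hint : IntegrableOn (fun t : ℝ => t ^ (c - 1) * Real.exp (-((z.re - 1) * t))) (Ioi 0) := by
    have := integrableOn_rpow_mul_exp_neg_mul_rpow (p := 1) (s := c - 1) (by linarith)
      one_pos hr
    simpa only [rpow_one, neg_mul] using this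
  have hint' := hint.mono_set (Ioc_subset_Ioi_self : Ioc (0 : ℝ) 1 ⊆ Ioi 0)
  rw [← Real.integral_rpow_mul_exp_neg_mul_Ioi hc hr, Complex.betaIntegral]
  refine (intervalIntegral.norm_integral_le_of_norm_le zero_le_one
    (g := fun t : ℝ => t ^ (c - 1) * Real.exp (-((z.re - 1) * t)))
    (Eventually.of_forall fun t ht => ?_)
    ((intervalIntegrable_iff_integrableOn_Ioc_of_le zero_le_one).2 hint')).trans ?_
  · have h1 : (0 : ℝ) ≤ 1 - t := by linarith [ht.2]
    have h2 : (1 - (t : ℂ)) = ((1 - t : ℝ) : ℂ) := by push_cast; ring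
    rw [norm_mul, Complex.norm_cpow_eq_rpow_re_of_pos ht.1, h2,
      Complex.norm_cpow_eq_rpow_re_of_nonneg h1 (by simpa using hr.ne')]
    simp only [Complex.sub_re, Complex.ofReal_re, Complex.one_re]
    refine mul_le_mul_of_nonneg_left ?_ (rpow_nonneg ht.1.le _)
    calc (1 - t) ^ (z.re - 1) ≤ (Real.exp (-t)) ^ (z.re - 1) :=
          rpow_le_rpow h1 (one_sub_le_exp_neg t) hr.le
      _ = Real.exp (-((z.re - 1) * t)) := by rw [← Real.exp_mul]; ring_nf
  · rw [intervalIntegral.integral_of_le zero_le_one]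
    refine setIntegral_mono_set hint ?_ Ioc_subset_Ioi_self.eventuallyLE
    filter_upwards [ae_restrict_mem measurableSet_Ioi] with t ht
    exact mul_nonneg (rpow_nonneg (le_of_lt ht) _) (Real.exp_pos _).le

theorem Complex.norm_Gamma_div_Gamma_add_le {c : ℝ} (hc : 0 < c) {z : ℂ} (hz : 1 < z.re) :
    ‖Complex.Gamma z / Complex.Gamma (z + c)‖ ≤ (z.re - 1) ^ (-c) := by
  have hG : 0 < Real.Gamma c := Real.Gamma_pos_of_pos hc
  have h := Complex.norm_betaIntegral_ofReal_le hc hz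
  rw [Complex.betaIntegral_eq_Gamma_mul_div _ _ (by simpa using hc) (by linarith),
    Complex.Gamma_ofReal, mul_div_assoc, norm_mul, Complex.norm_of_nonneg hG.le, mul_comm,
    add_comm] at h
  rw [rpow_neg (by linarith), ← inv_rpow (by linarith), ← one_div]
  exact le_of_mul_le_mul_right h hG

/-- In the sector `‖z‖ ≤ 3 Re z`, the ratio `Γ(z + a) / Γ(z + b)` is `O((Re z) ^ (a - b))`. -/
theorem Complex.exists_norm_Gamma_div_Gamma_le (a b : ℝ) :
    ∃ C > (0 : ℝ), ∃ R > (0 : ℝ), ∀ z : ℂ, R ≤ z.re → ‖z‖ ≤ 3 * z.re →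
      ‖Complex.Gamma (z + a) / Complex.Gamma (z + b)‖ ≤ C * z.re ^ (a - b) := by
  obtain ⟨N, hN⟩ := exists_nat_gt (a - b)
  induction N generalizing b with
  | zero =>
    have hc : 0 < b - a := by simp at hN; linarith
    refine ⟨2 ^ (b - a), by positivity, 2 * |a| + 3, by positivity, fun z hz _ => ?_⟩
    have ha := neg_abs_le a
    have ha' := abs_nonneg a
    have h := Complex.norm_Gamma_div_Gamma_add_le hc (z := z + a) (by simp; linarith)
    have e : z + (a : ℂ) + ((b - a : ℝ) : ℂ) = z + b := by push_cast; ring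
    rw [e] at h
    refine h.trans ?_
    have hz0 : 0 < z.re := by linarith
    calc ((z + a).re - 1) ^ (-(b - a)) ≤ (z.re / 2) ^ (-(b - a)) := by
          refine rpow_le_rpow_of_nonpos (by linarith) ?_ (by linarith)
          simp; linarith
      _ = 2 ^ (b - a) * z.re ^ (a - b) := by
          rw [div_rpow hz0.le two_pos.le, rpow_neg two_pos.le, div_inv_eq_mul, mul_comm, neg_sub]
  | succ N ih =>
    obtain ⟨C, hC, R, hR, h⟩ := ih (b + 1) (by push_cast at hN; linarith)
    refine ⟨4 * C, by positivity, max R (|b| + 1), lt_max_of_lt_left hR, fun z hz hz3 => ?_⟩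
    have hzR := (le_max_left _ _).trans hz
    have hzb := (le_max_right _ _).trans hz
    have hz0 : 0 < z.re := hR.trans_le hzR
    have hb := neg_abs_le b
    have hne : z + (b : ℂ) ≠ 0 := fun h0 => by
      have := congrArg Complex.re h0
      simp at this
      linarith
    have e : Complex.Gamma (z + a) / Complex.Gamma (z + b)
        = (z + b) * (Complex.Gamma (z + a) / Complex.Gamma (z + (b + 1 : ℝ))) := by
      rw [show z + ((b + 1 : ℝ) : ℂ) = z + b + 1 by push_cast; ring, Complex.Gamma_add_one _ hne]
      field_simp
    have hn : ‖z + (b : ℂ)‖ ≤ 4 * z.re := by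
      refine (norm_add_le _ _).trans ?_
      rw [Complex.norm_real, Real.norm_eq_abs]
      linarith
    rw [e, norm_mul]
    calc _ ≤ 4 * z.re * (C * z.re ^ (a - (b + 1))) :=
          mul_le_mul hn (h z hzR hz3) (norm_nonneg _) (by positivity)
      _ = 4 * C * (z.re ^ (1 : ℝ) * z.re ^ (a - (b + 1))) := by rw [rpow_one]; ring
      _ = 4 * C * z.re ^ (a - b) := by rw [← rpow_add hz0]; ring_nf

theorem Complex.analyticOnNhd_Gamma_div_Gamma (a b : ℝ) :
    AnalyticOnNhd ℂ (fun z : ℂ => Complex.Gamma (z + a) / Complex.Gamma (z + b))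
      {z | max |a| |b| < z.re} := by
  refine DifferentiableOn.analyticOnNhd (fun z hz => ?_)
    (isOpen_lt continuous_const Complex.continuous_re)
  have hz' := max_lt_iff.1 (show max |a| |b| < z.re from hz)
  have key (c : ℝ) (hc : |c| < z.re) : 0 < (z + (c : ℂ)).re := by
    have := neg_abs_le c
    simp; linarith
  have hd (c : ℝ) (hc : |c| < z.re) :
      DifferentiableAt ℂ (fun z : ℂ => Complex.Gamma (z + c)) z := by
    refine DifferentiableAt.comp z (Complex.differentiableAt_Gamma _ fun m hm => ?_)
      (by fun_prop)
    have h0 := key c hc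
    rw [hm] at h0
    simp at h0
    linarith [(Nat.cast_nonneg m : (0 : ℝ) ≤ m)]
  exact ((hd a hz'.1).div (hd b hz'.2)
    (Complex.Gamma_ne_zero_of_re_pos (key b hz'.2))).differentiableWithinAt

/-- Real iterated derivatives are the restrictions of complex ones. -/
theorem AnalyticOnNhd.iteratedDeriv_re_ofReal {f : ℂ → ℂ} {U : Set ℂ} (hU : IsOpen U)
    (hf : AnalyticOnNhd ℂ f U) (n : ℕ) {x : ℝ} (hx : (x : ℂ) ∈ U) :
    iteratedDeriv n (fun t : ℝ => (f t).re) x = (iteratedDeriv n f x).re := by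
  induction n generalizing x with
  | zero => simp
  | succ n ih =>
    have hev : iteratedDeriv n (fun t : ℝ => (f t).re) =ᶠ[𝓝 x]
        fun t : ℝ => (iteratedDeriv n f t).re := by
      filter_upwards [(hU.preimage Complex.continuous_ofReal).mem_nhds hx] with t ht
      exact ih ht
    rw [iteratedDeriv_succ, hev.deriv_eq, iteratedDeriv_succ]
    have hd : DifferentiableAt ℂ (iteratedDeriv n f) x := by
      rw [iteratedDeriv_eq_iterate]
      exact ((hf.iterated_deriv n) x hx).differentiableAt
    exact hd.hasDerivAt.real_of_complex.deriv

/-- Derivative bounds for Gamma ratios (equation (3.22) in the proof of Lemma 3.1):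
for `a, b ∈ ℝ` and every integer `μ ≥ 1` there are `C > 0` and `R > 0` such that for all
`ξ ≥ R` the function `g(ξ) := Γ(ξ+a)/Γ(ξ+b)` is `μ`-times (continuously) differentiable at
`ξ` and `|g^{(μ)}(ξ)| ≤ C·ξ^{a−b−μ}`. -/
theorem gamma_ratio_derivative_bounds (a b : ℝ) :
    ∀ μ : ℕ, 1 ≤ μ →
      ∃ C > (0 : ℝ), ∃ R > (0 : ℝ), ∀ ξ : ℝ, R ≤ ξ →
        ContDiffAt ℝ (μ : ℕ∞) (fun x : ℝ => Real.Gamma (x + a) / Real.Gamma (x + b)) ξ ∧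
        |iteratedDeriv μ (fun x : ℝ => Real.Gamma (x + a) / Real.Gamma (x + b)) ξ|
          ≤ C * ξ ^ (a - b - μ) := by
  intro μ _
  obtain ⟨C, hC, R, hR, hbound⟩ := Complex.exists_norm_Gamma_div_Gamma_le a b
  set f : ℂ → ℂ := fun z => Complex.Gamma (z + a) / Complex.Gamma (z + b) with hf
  have hfa : AnalyticOnNhd ℂ f {z | max |a| |b| < z.re} :=
    Complex.analyticOnNhd_Gamma_div_Gamma a b
  have hg : (fun x : ℝ => Real.Gamma (x + a) / Real.Gamma (x + b))
      = fun x : ℝ => (f x).re := by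
    funext x
    simp only [hf, ← Complex.ofReal_add, Complex.Gamma_ofReal, ← Complex.ofReal_div,
      Complex.ofReal_re]
  refine ⟨μ.factorial * (C * 2 ^ |a - b|) * 2 ^ μ, by positivity,
    2 * (R + max |a| |b|), by positivity, fun ξ hξ => ?_⟩
  have hM : 0 ≤ max |a| |b| := (abs_nonneg a).trans (le_max_left _ _)
  have hξ0 : 0 < ξ := by linarith
  have hmem : (ξ : ℂ) ∈ {z : ℂ | max |a| |b| < z.re} := by
    simp only [mem_ofPred_eq, Complex.ofReal_re]
    linarith
  rw [hg]
  refine ⟨(hfa _ hmem).contDiffAt.real_of_complex, ?_⟩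
  rw [hfa.iteratedDeriv_re_ofReal (isOpen_lt continuous_const Complex.continuous_re) μ hmem]
  have hre (z : ℂ) (hz : z ∈ closedBall (ξ : ℂ) (ξ / 2)) :
      |z.re - ξ| ≤ ξ / 2 ∧ ‖z‖ ≤ ξ + ξ / 2 := by
    rw [mem_closedBall, dist_eq_norm] at hz
    refine ⟨by simpa using (Complex.abs_re_le_norm _).trans hz, ?_⟩
    calc ‖z‖ = ‖(ξ : ℂ) + (z - ξ)‖ := by ring_nf
      _ ≤ ‖(ξ : ℂ)‖ + ‖z - ξ‖ := norm_add_le _ _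
      _ ≤ ξ + ξ / 2 := by
        rw [Complex.norm_of_nonneg hξ0.le]
        linarith
  have hdiff : DiffContOnCl ℂ f (ball (ξ : ℂ) (ξ / 2)) := by
    refine DifferentiableOn.diffContOnCl_ball hfa.differentiableOn fun z hz => ?_
    have := abs_le.1 (hre z hz).1
    simp only [mem_ofPred_eq]
    linarith
  have hsphere (z : ℂ) (hz : z ∈ sphere (ξ : ℂ) (ξ / 2)) :
      ‖f z‖ ≤ C * 2 ^ |a - b| * ξ ^ (a - b) := by
    obtain ⟨h1, h2⟩ := hre z (sphere_subset_closedBall hz)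
    have h1 := abs_le.1 h1
    have hz0 : 0 < z.re := by linarith
    refine (hbound z (by linarith) (by linarith)).trans ?_
    rw [mul_assoc]
    refine mul_le_mul_of_nonneg_left ?_ hC.le
    rcases le_total 0 (a - b) with h | h
    · rw [abs_of_nonneg h, ← mul_rpow two_pos.le hξ0.le]
      exact rpow_le_rpow hz0.le (by linarith) h
    · rw [abs_of_nonpos h, rpow_neg two_pos.le, mul_comm, ← div_eq_mul_inv,
        ← div_rpow hξ0.le two_pos.le]
      exact rpow_le_rpow_of_nonpos (by linarith) (by linarith) h
  refine (Complex.abs_re_le_norm _).trans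
    ((Complex.norm_iteratedDeriv_le_of_forall_mem_sphere_norm_le μ (by linarith) hdiff
      hsphere).trans_eq ?_)
  rw [rpow_sub hξ0 (a - b), rpow_natCast, div_pow]
  field_simp
end

section
/- Two-term asymptotics of T¹_α (Lemma 3.6, equation (3.30) with 𝒦 = 3). Let α ∈ (0,1) ∪ (1,2). There exists C > 0 such that for every integer n ≥ 1, | T¹_α(n) − Γ(1−α)/Γ(1−α/2)² − ( Γ(2−α)/((α−1)·Γ(1−α/2)·Γ(α/2)) )·n^{α−1} | ≤ C·n^{α−3}. In particular the expansion of T¹_α(n) contains no term of order n^{α−2}. -/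
open Real

open Filter Topology

lemma abs_log_one_add_sub_log_one_sub_sub_le {x : ℝ} (hx : |x| ≤ 1 / 3) :
    |Real.log (1 + x) - Real.log (1 - x) - 2 * x| ≤ 3 * |x| ^ 3 := by
  have h1 := Real.abs_log_sub_add_sum_range_le (x := x) (by linarith) 2
  have h2 := Real.abs_log_sub_add_sum_range_le (x := -x) (by rw [abs_neg]; linarith) 2
  have hq : |x| ^ 3 / (1 - |x|) ≤ 3 / 2 * |x| ^ 3 := by
    rw [div_le_iff₀ (by linarith)]
    nlinarith [pow_nonneg (abs_nonneg x) 3]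
  simp only [Finset.sum_range_succ, Finset.sum_range_zero, abs_neg, sub_neg_eq_add] at h1 h2
  norm_num at h1 h2
  have h1' := abs_le.1 (h1.trans hq)
  have h2' := abs_le.1 (h2.trans hq)
  rw [abs_le]
  constructor <;> linarith [h1'.1, h1'.2, h2'.1, h2'.2]

lemma log_add_sub_log_sub_eq {m t : ℝ} (h1 : 0 < m + t) (h2 : 0 < m - t) :
    Real.log (m + t) - Real.log (m - t) = Real.log (1 + t / m) - Real.log (1 - t / m) := by
  have hm : 0 < m := by linarith
  have e1 : 1 + t / m = (m + t) / m := by field_simp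
  have e2 : 1 - t / m = (m - t) / m := by field_simp
  rw [e1, e2, Real.log_div h1.ne' hm.ne', Real.log_div h2.ne' hm.ne']
  ring

lemma abs_log_ratio_sub_mul_log_le {a n : ℝ} (ha0 : 0 < a) (ha1 : a < 1) (hn : 1 ≤ n) :
    |Real.log (a + n) - Real.log (1 - a + n)
        - (2 * a - 1) * (Real.log (n + 1) - Real.log n)|
      ≤ 1 / n ^ 2 - 1 / (n + 1) ^ 2 := by
  set y := 2 * a - 1 with hy
  set u := 1 / (2 * n + 1) with hu
  have hu0 : 0 < u := by positivity
  have hu3 : u ≤ 1 / 3 := by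
    rw [hu]; exact one_div_le_one_div_of_le (by norm_num) (by linarith)
  have hy1 : |y| ≤ 1 := by rw [abs_le]; constructor <;> linarith
  have e1 : Real.log (a + n) - Real.log (1 - a + n)
      = Real.log (1 + y * u) - Real.log (1 - y * u) := by
    have := log_add_sub_log_sub_eq (m := n + 1 / 2) (t := y / 2) (by linarith) (by linarith)
    have h3 : y / 2 / (n + 1 / 2) = y * u := by rw [hu]; field_simp
    rw [h3] at this
    rw [← this]
    congr 2 <;> rw [hy] <;> ring
  have e2 : Real.log (n + 1) - Real.log n = Real.log (1 + u) - Real.log (1 - u) := by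
    have := log_add_sub_log_sub_eq (m := n + 1 / 2) (t := 1 / 2) (by linarith) (by linarith)
    have h3 : 1 / 2 / (n + 1 / 2) = u := by rw [hu]; field_simp
    rw [h3] at this
    rw [← this]
    congr 2 <;> ring
  have hyu : |y * u| ≤ u := by
    rw [abs_mul, abs_of_pos hu0]; nlinarith
  have b1 := abs_log_one_add_sub_log_one_sub_sub_le (x := y * u) (hyu.trans hu3)
  have b2 := abs_log_one_add_sub_log_one_sub_sub_le (x := u) (by rwa [abs_of_pos hu0])
  rw [abs_of_pos hu0] at b2
  have b1' : |Real.log (1 + y * u) - Real.log (1 - y * u) - 2 * (y * u)| ≤ 3 * u ^ 3 :=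
    b1.trans (by gcongr)
  have key : 6 * u ^ 3 ≤ 1 / n ^ 2 - 1 / (n + 1) ^ 2 := by
    have hn0 : 0 < n := by linarith
    have e : 1 / n ^ 2 - 1 / (n + 1) ^ 2 = (2 * n + 1) / (n ^ 2 * (n + 1) ^ 2) := by
      field_simp; ring
    rw [e, hu, div_pow, mul_div_assoc', div_le_div_iff₀ (by positivity) (by positivity)]
    have : 0 < n ^ 2 * (n + 1) ^ 2 := by positivity
    nlinarith [sq_nonneg (n * (n + 1)), mul_pos hn0 hn0]
  rw [e1, e2]
  refine le_trans ?_ key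
  have e3 : Real.log (1 + y * u) - Real.log (1 - y * u)
        - y * (Real.log (1 + u) - Real.log (1 - u))
      = (Real.log (1 + y * u) - Real.log (1 - y * u) - 2 * (y * u))
        - y * (Real.log (1 + u) - Real.log (1 - u) - 2 * u) := by ring
  rw [e3]
  refine (abs_sub _ _).trans ?_
  rw [abs_mul]
  nlinarith [mul_le_mul hy1 b2 (abs_nonneg _) zero_le_one]

/-- The ratio `Γ(a + n) / Γ(1 - a + n)`. -/
noncomputable def gammaRatio (a : ℝ) (n : ℕ) : ℝ :=
  Real.Gamma (a + n) / Real.Gamma (1 - a + n)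

lemma gammaRatio_pos {a : ℝ} (ha0 : 0 < a) (ha1 : a < 1) (n : ℕ) : 0 < gammaRatio a n := by
  have : 0 < 1 - a := by linarith
  exact div_pos (Real.Gamma_pos_of_pos (by positivity)) (Real.Gamma_pos_of_pos (by positivity))

lemma gammaRatio_succ {a : ℝ} (ha0 : 0 < a) (ha1 : a < 1) (n : ℕ) :
    gammaRatio a (n + 1) = gammaRatio a n * ((a + n) / (1 - a + n)) := by
  have hb : 0 < 1 - a := by linarith
  have h1 : 0 < a + n := by positivity
  have h2 : 0 < 1 - a + n := by positivity
  have h3 := (Real.Gamma_pos_of_pos h2).ne'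
  unfold gammaRatio
  push_cast
  rw [← add_assoc, ← add_assoc, Real.Gamma_add_one h1.ne', Real.Gamma_add_one h2.ne']
  field_simp

lemma sum_gamma_div_eq {a : ℝ} (ha0 : 0 < a) (ha1 : a < 1) (n : ℕ) :
    (2 * a - 1) * ∑ k ∈ Finset.range n,
        Real.Gamma (a + k) / ((1 - a + k) * Real.Gamma (1 - a + k))
      = gammaRatio a n - gammaRatio a 0 := by
  rw [← Finset.sum_range_sub, Finset.mul_sum]
  refine Finset.sum_congr rfl fun k _ => ?_
  have hb : 0 < 1 - a := by linarith
  have h2 : 0 < 1 - a + k := by positivity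
  have h3 := (Real.Gamma_pos_of_pos h2).ne'
  rw [gammaRatio_succ ha0 ha1]
  unfold gammaRatio
  field_simp
  ring

lemma gammaRatio_eq_prod {a : ℝ} (ha0 : 0 < a) (ha1 : a < 1) (n : ℕ) :
    gammaRatio a n = gammaRatio a 0 *
      ((∏ j ∈ Finset.range n, (a + j)) / ∏ j ∈ Finset.range n, (1 - a + j)) := by
  induction n with
  | zero => simp
  | succ n ih =>
    rw [gammaRatio_succ ha0 ha1, ih, Finset.prod_range_succ, Finset.prod_range_succ,
      mul_assoc, div_mul_div_comm]

lemma tendsto_gammaRatio_mul_rpow {a : ℝ} (ha0 : 0 < a) (ha1 : a < 1) :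
    Tendsto (fun n : ℕ => gammaRatio a n * (n : ℝ) ^ (1 - 2 * a)) atTop (𝓝 1) := by
  have hb : 0 < 1 - a := by linarith
  have hGa := (Real.Gamma_pos_of_pos ha0).ne'
  have hGb := (Real.Gamma_pos_of_pos hb).ne'
  have h1 := ((Real.GammaSeq_tendsto_Gamma (1 - a)).div
    (Real.GammaSeq_tendsto_Gamma a) hGa).const_mul (gammaRatio a 0)
  have h2 : Tendsto (fun n : ℕ => (1 - a + n) / (a + n)) atTop (𝓝 1) := by
    have h := (tendsto_atTop_add_const_left atTop a (tendsto_natCast_atTop_atTop (R := ℝ))).inv_tendsto_atTop.const_mul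
      (1 - 2 * a) |>.const_add 1
    simp only [mul_zero, add_zero] at h
    refine h.congr fun n => ?_
    have : 0 < a + n := by positivity
    simp only [Pi.inv_apply]
    field_simp
    ring
  have h3 := h1.mul h2
  have e : gammaRatio a 0 * (Real.Gamma (1 - a) / Real.Gamma a) * 1 = 1 := by
    simp only [gammaRatio, Nat.cast_zero, add_zero]
    field_simp
  rw [e] at h3
  refine h3.congr' ?_
  filter_upwards [eventually_ge_atTop 1] with n hn
  have hn0 : (0 : ℝ) < n := by exact_mod_cast hn
  have hs : gammaRatio a n = gammaRatio a (n + 1) * ((1 - a + n) / (a + n)) := by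
    have : 0 < a + n := by positivity
    have : 0 < 1 - a + n := by positivity
    rw [gammaRatio_succ ha0 ha1]
    field_simp
  have hp1 : 0 < ∏ j ∈ Finset.range (n + 1), (a + (j : ℝ)) :=
    Finset.prod_pos fun j _ => by positivity
  have hp2 : 0 < ∏ j ∈ Finset.range (n + 1), (1 - a + (j : ℝ)) :=
    Finset.prod_pos fun j _ => by positivity
  have hr : (n : ℝ) ^ (1 - 2 * a) = (n : ℝ) ^ (1 - a) / (n : ℝ) ^ a := by
    rw [← Real.rpow_sub hn0]; congr 1; ring
  have hra : 0 < (n : ℝ) ^ a := Real.rpow_pos_of_pos hn0 a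
  have hf : (0 : ℝ) < n.factorial := by exact_mod_cast n.factorial_pos
  rw [hs, gammaRatio_eq_prod ha0 ha1 (n + 1), hr]
  simp only [Pi.div_apply, Real.GammaSeq]
  field_simp

lemma abs_gammaRatio_sub_rpow_le {a : ℝ} (ha0 : 0 < a) (ha1 : a < 1) {n : ℕ} (hn : 1 ≤ n) :
    |gammaRatio a n - (n : ℝ) ^ (2 * a - 1)| ≤ 2 * (n : ℝ) ^ (2 * a - 3) := by
  have hb : 0 < 1 - a := by linarith
  set L : ℕ → ℝ := fun n => Real.log (gammaRatio a n * (n : ℝ) ^ (1 - 2 * a)) with hL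
  have hLeq : ∀ k : ℕ, 1 ≤ k →
      L k = Real.log (gammaRatio a k) - (2 * a - 1) * Real.log k := fun k hk => by
    have hk0 : (0 : ℝ) < k := by exact_mod_cast hk
    simp only [hL]
    rw [Real.log_mul (gammaRatio_pos ha0 ha1 k).ne' (Real.rpow_pos_of_pos hk0 _).ne',
      Real.log_rpow hk0]
    ring
  have hstep : ∀ k : ℕ, 1 ≤ k →
      |L (k + 1) - L k| ≤ 1 / (k : ℝ) ^ 2 - 1 / ((k : ℝ) + 1) ^ 2 := fun k hk => by
    have hk1 : (1 : ℝ) ≤ k := by exact_mod_cast hk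
    have h1 : 0 < a + k := by positivity
    have h2 : 0 < 1 - a + k := by positivity
    have := abs_log_ratio_sub_mul_log_le ha0 ha1 hk1
    convert this using 2
    rw [hLeq _ hk, hLeq _ (by omega), gammaRatio_succ ha0 ha1,
      Real.log_mul (gammaRatio_pos ha0 ha1 k).ne' (div_pos h1 h2).ne',
      Real.log_div h1.ne' h2.ne']
    push_cast
    ring
  have hsum : ∀ N : ℕ, n ≤ N → |L N - L n| ≤ 1 / (n : ℝ) ^ 2 - 1 / (N : ℝ) ^ 2 := fun N hN => by
    induction N, hN using Nat.le_induction with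
    | base => simp
    | succ N hN ih =>
      have h := hstep N (hn.trans hN)
      have := abs_add_le (L (N + 1) - L N) (L N - L n)
      rw [sub_add_sub_cancel] at this
      push_cast
      linarith
  have hlim : Tendsto L atTop (𝓝 0) := by
    have := (tendsto_gammaRatio_mul_rpow ha0 ha1).log one_ne_zero
    rwa [Real.log_one] at this
  have hn1 : (1 : ℝ) ≤ n := by exact_mod_cast hn
  have hn0 : (0 : ℝ) < n := by linarith
  have hLn : |L n| ≤ 1 / (n : ℝ) ^ 2 := by
    have h := (hlim.sub_const (L n)).abs
    rw [zero_sub, abs_neg] at h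
    refine le_of_tendsto h ?_
    filter_upwards [eventually_ge_atTop n] with N hN
    have : 0 ≤ 1 / (N : ℝ) ^ 2 := by positivity
    linarith [hsum N hN]
  have hL1 : |L n| ≤ 1 := hLn.trans (by
    rw [div_le_one (by positivity)]; exact one_le_pow₀ hn1)
  have hexp := Real.abs_exp_sub_one_le hL1
  have hpos : 0 < gammaRatio a n * (n : ℝ) ^ (1 - 2 * a) :=
    mul_pos (gammaRatio_pos ha0 ha1 n) (Real.rpow_pos_of_pos hn0 _)
  simp only [hL] at hexp hLn
  rw [Real.exp_log hpos] at hexp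
  have e1 : (n : ℝ) ^ (1 - 2 * a) * (n : ℝ) ^ (2 * a - 1) = 1 := by
    rw [← Real.rpow_add hn0]; simp
  have e2 : (n : ℝ) ^ (2 * a - 3) = 1 / (n : ℝ) ^ 2 * (n : ℝ) ^ (2 * a - 1) := by
    have : 2 * a - 3 = 2 * a - 1 - (2 : ℕ) := by push_cast; ring
    rw [this, Real.rpow_sub_natCast hn0.ne']
    ring
  have hp : 0 < (n : ℝ) ^ (2 * a - 1) := Real.rpow_pos_of_pos hn0 _
  have e3 : gammaRatio a n - (n : ℝ) ^ (2 * a - 1)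
      = (gammaRatio a n * (n : ℝ) ^ (1 - 2 * a) - 1) * (n : ℝ) ^ (2 * a - 1) := by
    rw [sub_mul, mul_assoc, e1]; ring
  rw [e3, abs_mul, abs_of_pos hp, e2, ← mul_assoc]
  gcongr
  linarith

/-- Two-term asymptotics of `T¹_α` (Lemma 3.6, equation (3.30) with 𝒦 = 3): for
`α ∈ (0,1) ∪ (1,2)` there is `C > 0` such that for every integer `n ≥ 1`,
`|T¹_α(n) − Γ(1−α)/Γ(1−α/2)² − (Γ(2−α)/((α−1)Γ(1−α/2)Γ(α/2)))·n^{α−1}| ≤ C·n^{α−3}`. -/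
theorem T1_two_term_asymptotics (α : ℝ)
    (hα : α ∈ Set.Ioo (0 : ℝ) 1 ∪ Set.Ioo (1 : ℝ) 2) :
    ∃ C > (0 : ℝ), ∀ n : ℕ, 1 ≤ n →
      |T1 α n - Real.Gamma (1 - α) / (Real.Gamma (1 - α / 2)) ^ 2
          - (Real.Gamma (2 - α) / ((α - 1) * Real.Gamma (1 - α / 2) * Real.Gamma (α / 2)))
              * (n : ℝ) ^ (α - 1)|
        ≤ C * (n : ℝ) ^ (α - 3) := by
  have hα0 : 0 < α := by rcases hα with h | h <;> linarith [h.1]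
  have hα2 : α < 2 := by rcases hα with h | h <;> linarith [h.2]
  have hα1 : α - 1 ≠ 0 := by
    rcases hα with h | h
    · exact (sub_neg.2 h.2).ne
    · exact (sub_pos.2 h.1).ne'
  have ha0 : 0 < α / 2 := by linarith
  have ha1 : α / 2 < 1 := by linarith
  have hGa := (Real.Gamma_pos_of_pos ha0).ne'
  have hGb := (Real.Gamma_pos_of_pos (sub_pos.2 ha1)).ne'
  set D := Real.Gamma (2 - α) / ((α - 1) * Real.Gamma (1 - α / 2) * Real.Gamma (α / 2)) with hD
  have hG : Real.Gamma (2 - α) = (1 - α) * Real.Gamma (1 - α) := by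
    rw [← Real.Gamma_add_one (fun h => hα1 (by linarith))]
    congr 1; ring
  refine ⟨|D| * 2 + 1, by positivity, fun n hn => ?_⟩
  have hT : T1 α n - Real.Gamma (1 - α) / (Real.Gamma (1 - α / 2)) ^ 2 - D * (n : ℝ) ^ (α - 1)
      = D * (gammaRatio (α / 2) n - (n : ℝ) ^ (α - 1)) := by
    have hs := sum_gamma_div_eq ha0 ha1 n
    rw [mul_div_cancel₀ α two_ne_zero] at hs
    have h0 : D * gammaRatio (α / 2) 0 = -(Real.Gamma (1 - α) / Real.Gamma (1 - α / 2) ^ 2) := by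
      simp only [gammaRatio, Nat.cast_zero, add_zero, hD, hG]
      field_simp
      ring
    have h1 : T1 α n = D * (gammaRatio (α / 2) n - gammaRatio (α / 2) 0) := by
      rw [← hs, T1, hD]
      field_simp
    rw [h1]
    linear_combination -h0
  have hb := abs_gammaRatio_sub_rpow_le ha0 ha1 hn
  rw [mul_div_cancel₀ α two_ne_zero] at hb
  have hp : 0 ≤ (n : ℝ) ^ (α - 3) := by positivity
  rw [hT, abs_mul]
  nlinarith [mul_le_mul_of_nonneg_left hb (abs_nonneg D)]
end

section
/- Asymptotic expansion of the dispersion symbol L_α (Lemma 3.5 with 𝒦 = 3, α ≠ 1). Let α ∈ (0,1) ∪ (1,2) and set 𝕍_α := α·c_α·Γ(1−α)/((2−α)·Γ(1−α/2)²) and c¹_α := (c_α/(2−α))·Γ(3−α)/((α−1)·Γ(1−α/2)·Γ(α/2)). Then there exists C > 0 such that for every integer n ≥ 1, | L_α(n) − 𝕍_α − c¹_α·n^{α−1} | ≤ C·n^{α−3}. In particular the expansion of L_α(n) contains no term of order n^{α−2}. -/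
open Real

open Filter Topology

lemma Real.abs_log_one_add_sub_log_one_sub_sub_two_mul_le {u : ℝ} (hu : |u| < 1) :
    |log (1 + u) - log (1 - u) - 2 * u| ≤ 2 * (|u| ^ 3 / (1 - |u|)) := by
  have h₁ := abs_log_sub_add_sum_range_le hu 2
  have h₂ := abs_log_sub_add_sum_range_le (x := -u) (by rwa [abs_neg]) 2
  simp only [Finset.sum_range_succ, Finset.sum_range_zero, abs_neg, sub_neg_eq_add] at h₁ h₂
  norm_num at h₁ h₂
  rw [abs_le] at h₁ h₂ ⊢
  constructor <;> linarith [h₁.1, h₁.2, h₂.1, h₂.2]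

lemma Real.abs_log_add_sub_log_sub_sub_le {x b : ℝ} (hx : 3 / 2 ≤ x) (hb : |b| ≤ 1 / 2) :
    |log (x + b) - log (x - b) - 2 * b / x| ≤ 3 / 8 / x ^ 3 := by
  have hx0 : 0 < x := by linarith
  have hu : |b / x| ≤ 1 / 2 / x := by
    rw [abs_div, abs_of_pos hx0]; gcongr
  have hx3 : 1 / 2 / x ≤ 1 / 3 := by
    rw [div_le_iff₀ hx0]; linarith
  have hu3 : |b / x| ≤ 1 / 3 := hu.trans hx3
  have key := abs_log_one_add_sub_log_one_sub_sub_two_mul_le (u := b / x) (by linarith)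
  have hub := abs_le.1 hu3
  have e₁ : log (x + b) = log x + log (1 + b / x) := by
    rw [← log_mul hx0.ne' (by linarith [hub.1])]; congr 1; field_simp
  have e₂ : log (x - b) = log x + log (1 - b / x) := by
    rw [← log_mul hx0.ne' (by linarith [hub.2])]; congr 1; field_simp
  calc |log (x + b) - log (x - b) - 2 * b / x|
      = |log (1 + b / x) - log (1 - b / x) - 2 * (b / x)| := by
        rw [e₁, e₂]; congr 1; ring
    _ ≤ 2 * (|b / x| ^ 3 / (1 - |b / x|)) := key
    _ ≤ 2 * ((1 / 2 / x) ^ 3 / (1 - 1 / 3)) := by gcongr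
    _ = 3 / 8 / x ^ 3 := by field_simp; norm_num

/-- The logarithm of `Γ(n + a) / Γ(n + 1 - a)`, normalised by its leading order `n ^ (2 * a - 1)`. -/
noncomputable def logGammaRatio (a : ℝ) (n : ℕ) : ℝ :=
  log (Gamma (a + n)) - log (Gamma (1 - a + n)) - (2 * a - 1) * log n

lemma Real.log_Gamma_add_one {y : ℝ} (hy : 0 < y) :
    log (Gamma (y + 1)) = log (Gamma y) + log y := by
  rw [Gamma_add_one hy.ne', log_mul hy.ne' (Gamma_pos_of_pos hy).ne', add_comm]

lemma tendsto_logGammaRatio_succ {a : ℝ} (ha : a ∈ Set.Ioo (0 : ℝ) 1) :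
    Tendsto (fun n : ℕ => logGammaRatio a (n + 1)) atTop (𝓝 0) := by
  have h1 : 0 < 1 - a := sub_pos.2 ha.2
  have hsub := (BohrMollerup.tendsto_log_gamma h1).sub (BohrMollerup.tendsto_log_gamma ha.1)
  have hlog := tendsto_log_nat_add_one_sub_log.const_mul (2 * a - 1)
  have H := (hsub.sub_const (log (Gamma (1 - a)) - log (Gamma a))).sub hlog
  rw [sub_self, mul_zero, sub_zero] at H
  refine H.congr fun n => ?_
  have e₁ := BohrMollerup.f_add_nat_eq (f := fun y => log (Gamma y)) log_Gamma_add_one h1 (n + 1)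
  have e₂ := BohrMollerup.f_add_nat_eq (f := fun y => log (Gamma y)) log_Gamma_add_one ha.1 (n + 1)
  simp only [BohrMollerup.logGammaSeq, logGammaRatio, e₁, e₂]
  push_cast
  ring

lemma abs_logGammaRatio_succ_sub_le {a : ℝ} (ha : a ∈ Set.Ioo (0 : ℝ) 1) {n : ℕ} (hn : 1 ≤ n) :
    |logGammaRatio a (n + 1) - logGammaRatio a n| ≤ 1 / (n : ℝ) ^ 2 - 1 / ((n : ℝ) + 1) ^ 2 := by
  obtain ⟨ha0, ha1⟩ := ha
  have hn' : (1 : ℝ) ≤ n := by exact_mod_cast hn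
  have hb : |a - 1 / 2| ≤ 1 / 2 := abs_le.2 ⟨by linarith, by linarith⟩
  have h₁ := abs_log_add_sub_log_sub_sub_le (x := n + 1 / 2) (by linarith) hb
  have h₂ := abs_log_add_sub_log_sub_sub_le (x := n + 1 / 2) (b := 1 / 2) (by linarith)
    (by norm_num [abs_of_pos])
  have e : logGammaRatio a (n + 1) - logGammaRatio a n =
      (log (n + 1 / 2 + (a - 1 / 2)) - log (n + 1 / 2 - (a - 1 / 2))
        - 2 * (a - 1 / 2) / (n + 1 / 2)) -
      (2 * (a - 1 / 2)) * (log (n + 1 / 2 + 1 / 2) - log (n + 1 / 2 - 1 / 2)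
        - 2 * (1 / 2) / (n + 1 / 2)) := by
    have g₁ := log_Gamma_add_one (y := a + n) (by linarith)
    have g₂ := log_Gamma_add_one (y := 1 - a + n) (by linarith)
    simp only [logGammaRatio]
    push_cast
    rw [← add_assoc, ← add_assoc, g₁, g₂,
      show (n : ℝ) + 1 / 2 + (a - 1 / 2) = a + n by ring,
      show (n : ℝ) + 1 / 2 - (a - 1 / 2) = 1 - a + n by ring,
      show (n : ℝ) + 1 / 2 + 1 / 2 = n + 1 by ring, show (n : ℝ) + 1 / 2 - 1 / 2 = n by ring]
    ring
  have hc : |2 * (a - 1 / 2)| ≤ 1 := abs_le.2 ⟨by linarith, by linarith⟩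
  calc _ ≤ 3 / 8 / ((n : ℝ) + 1 / 2) ^ 3 + 1 * (3 / 8 / ((n : ℝ) + 1 / 2) ^ 3) := by
        rw [e]
        refine (abs_sub _ _).trans (add_le_add h₁ ?_)
        rw [abs_mul]
        gcongr
    _ ≤ 2 * ((n : ℝ) + 1 / 2) / ((n : ℝ) + 1 / 2) ^ 4 := by
        rw [one_mul, ← add_div, div_le_div_iff₀ (by positivity) (by positivity)]
        have : 0 < ((n : ℝ) + 1 / 2) ^ 4 := by positivity
        nlinarith
    _ ≤ 2 * ((n : ℝ) + 1 / 2) / (n ^ 2 * ((n : ℝ) + 1) ^ 2) := by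
        gcongr
        nlinarith [sq_nonneg ((n : ℝ) + 1 / 2)]
    _ = _ := by field_simp; ring

lemma abs_logGammaRatio_le {a : ℝ} (ha : a ∈ Set.Ioo (0 : ℝ) 1) {n : ℕ} (hn : 1 ≤ n) :
    |logGammaRatio a n| ≤ 1 / (n : ℝ) ^ 2 := by
  obtain ⟨m, rfl⟩ := Nat.exists_eq_add_of_le' hn
  have hstep (k : ℕ) := abs_le.1 (abs_logGammaRatio_succ_sub_le ha (Nat.le_add_left 1 k))
  have hinv : Tendsto (fun k : ℕ => 1 / ((k + 1 : ℕ) : ℝ) ^ 2) atTop (𝓝 0) := by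
    have := (tendsto_one_div_add_atTop_nhds_zero_nat (𝕜 := ℝ)).pow 2
    simpa using this
  have hanti : Antitone fun k : ℕ => logGammaRatio a (k + 1) + 1 / ((k + 1 : ℕ) : ℝ) ^ 2 :=
    antitone_nat_of_succ_le fun k => by
      have := (hstep k).2
      push_cast at this ⊢
      linarith
  have hmono : Monotone fun k : ℕ => logGammaRatio a (k + 1) - 1 / ((k + 1 : ℕ) : ℝ) ^ 2 :=
    monotone_nat_of_le_succ fun k => by
      have := (hstep k).1
      push_cast at this ⊢
      linarith
  have hlim := tendsto_logGammaRatio_succ ha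
  have hlow := hanti.le_of_tendsto (hlim.add hinv) m
  have hupp := hmono.ge_of_tendsto (hlim.sub hinv) m
  exact abs_le.2 ⟨by linarith, by linarith⟩

lemma abs_Gamma_div_Gamma_sub_rpow_le {a : ℝ} (ha : a ∈ Set.Ioo (0 : ℝ) 1) {n : ℕ} (hn : 1 ≤ n) :
    |Gamma (a + n) / Gamma (1 - a + n) - (n : ℝ) ^ (2 * a - 1)| ≤
      2 * (n : ℝ) ^ (2 * a - 3) := by
  have hl := abs_logGammaRatio_le ha hn
  obtain ⟨ha0, ha1⟩ := ha
  have hn' : (1 : ℝ) ≤ n := by exact_mod_cast hn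
  have hn0 : (0 : ℝ) < n := by linarith
  have hg₁ : 0 < Gamma (a + n) := Gamma_pos_of_pos (by linarith)
  have hg₂ : 0 < Gamma (1 - a + n) := Gamma_pos_of_pos (by linarith)
  have hfac : Gamma (a + n) / Gamma (1 - a + n) =
      (n : ℝ) ^ (2 * a - 1) * exp (logGammaRatio a n) := by
    rw [logGammaRatio, rpow_def_of_pos hn0, ← exp_add,
      ← exp_log (div_pos hg₁ hg₂), log_div hg₁.ne' hg₂.ne']
    congr 1
    ring
  have hle1 : 1 / (n : ℝ) ^ 2 ≤ 1 := by
    rw [div_le_one (by positivity)]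
    exact one_le_pow₀ hn'
  have hexp := (abs_exp_sub_one_le (hl.trans hle1)).trans (mul_le_mul_of_nonneg_left hl two_pos.le)
  have hpow : (n : ℝ) ^ (2 * a - 3) = (n : ℝ) ^ (2 * a - 1) * (1 / (n : ℝ) ^ 2) := by
    rw [show 2 * a - 3 = (2 * a - 1) - (2 : ℕ) by push_cast; ring, rpow_sub_natCast hn0.ne']
    ring
  have hp : 0 < (n : ℝ) ^ (2 * a - 1) := rpow_pos_of_pos hn0 _
  calc |Gamma (a + n) / Gamma (1 - a + n) - (n : ℝ) ^ (2 * a - 1)|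
      = (n : ℝ) ^ (2 * a - 1) * |exp (logGammaRatio a n) - 1| := by
        rw [hfac, ← abs_of_pos hp, ← abs_mul, abs_of_pos hp]; congr 1; ring
    _ ≤ (n : ℝ) ^ (2 * a - 1) * (2 * (1 / (n : ℝ) ^ 2)) := by gcongr
    _ = 2 * (n : ℝ) ^ (2 * a - 3) := by rw [hpow]; ring

lemma sum_Gamma_div_Gamma {a : ℝ} (ha : a ∈ Set.Ioo (0 : ℝ) 1) (ha' : 2 * a - 1 ≠ 0) (n : ℕ) :
    ∑ k ∈ Finset.range n, Gamma (a + k) / ((1 - a + k) * Gamma (1 - a + k)) =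
      (Gamma (a + n) / Gamma (1 - a + n) - Gamma a / Gamma (1 - a)) / (2 * a - 1) := by
  obtain ⟨ha0, ha1⟩ := ha
  induction n with
  | zero => simp
  | succ n ih =>
    have hn0 : (0 : ℝ) ≤ n := n.cast_nonneg
    have h₁ : 0 < a + n := by linarith
    have h₂ : 0 < 1 - a + n := by linarith
    have hg₂ := (Gamma_pos_of_pos h₂).ne'
    have hg : Gamma (1 - a) ≠ 0 := (Gamma_pos_of_pos (by linarith)).ne'
    rw [Finset.sum_range_succ, ih]
    push_cast
    rw [← add_assoc, ← add_assoc, Gamma_add_one h₁.ne', Gamma_add_one h₂.ne']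
    have := h₂.ne'
    rw [eq_div_iff ha', add_mul, div_mul_cancel₀ _ ha']
    field_simp
    ring

lemma Lsymb_eq {α : ℝ} (hα : α ∈ Set.Ioo (0 : ℝ) 2) (hα1 : α ≠ 1) (n : ℕ) :
    Lsymb α n = α * cAlpha α * Gamma (1 - α) / ((2 - α) * (Gamma (1 - α / 2)) ^ 2) +
      (cAlpha α / (2 - α)) * Gamma (3 - α) / ((α - 1) * Gamma (1 - α / 2) * Gamma (α / 2)) *
        (Gamma (α / 2 + n) / Gamma (1 - α / 2 + n)) := by
  obtain ⟨h0, h2⟩ := hα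
  have h1 : α - 1 ≠ 0 := sub_ne_zero.2 hα1
  have h1' : 1 - α ≠ 0 := sub_ne_zero.2 hα1.symm
  have h2' : 2 - α ≠ 0 := by linarith
  have hg₁ : Gamma (α / 2) ≠ 0 := (Gamma_pos_of_pos (by linarith)).ne'
  have hg₂ : Gamma (1 - α / 2) ≠ 0 := (Gamma_pos_of_pos (by linarith)).ne'
  have e₂ : Gamma (2 - α) = (1 - α) * Gamma (1 - α) := by
    rw [← Gamma_add_one h1']; congr 1; ring
  have e₃ : Gamma (3 - α) = (2 - α) * ((1 - α) * Gamma (1 - α)) := by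
    rw [← e₂, ← Gamma_add_one h2']; congr 1; ring
  have hs := sum_Gamma_div_Gamma (a := α / 2) ⟨by linarith, by linarith⟩
    (by rwa [mul_div_cancel₀ _ two_ne_zero]) n
  rw [mul_div_cancel₀ _ two_ne_zero] at hs
  rw [Lsymb, T1, T2, hs, e₂, e₃]
  generalize Gamma (α / 2 + n) / Gamma (1 - α / 2 + n) = G
  field_simp
  ring

/-- Asymptotic expansion of the dispersion symbol `L_α` (Lemma 3.5 with 𝒦 = 3, α ≠ 1):
with `𝕍_α := α·c_α·Γ(1−α)/((2−α)·Γ(1−α/2)²)` and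
`c¹_α := (c_α/(2−α))·Γ(3−α)/((α−1)·Γ(1−α/2)·Γ(α/2))`, there exists `C > 0` such that
`|L_α(n) − 𝕍_α − c¹_α·n^{α−1}| ≤ C·n^{α−3}` for every integer `n ≥ 1`. -/
theorem L_asymptotics (α : ℝ)
    (hα : α ∈ Set.Ioo (0 : ℝ) 1 ∪ Set.Ioo (1 : ℝ) 2) :
    ∃ C > (0 : ℝ), ∀ n : ℕ, 1 ≤ n →
      |Lsymb α n
          - α * cAlpha α * Real.Gamma (1 - α) / ((2 - α) * (Real.Gamma (1 - α / 2)) ^ 2)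
          - (cAlpha α / (2 - α)) * Real.Gamma (3 - α)
              / ((α - 1) * Real.Gamma (1 - α / 2) * Real.Gamma (α / 2)) * (n : ℝ) ^ (α - 1)|
        ≤ C * (n : ℝ) ^ (α - 3) := by
  have hα' : α ∈ Set.Ioo (0 : ℝ) 2 := by
    rcases hα with h | h <;> exact ⟨by linarith [h.1], by linarith [h.2]⟩
  have hα1 : α ≠ 1 := by
    rcases hα with h | h
    exacts [h.2.ne, h.1.ne']
  set K := (cAlpha α / (2 - α)) * Gamma (3 - α) / ((α - 1) * Gamma (1 - α / 2) * Gamma (α / 2))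
    with hK
  refine ⟨2 * |K| + 1, by positivity, fun n hn => ?_⟩
  have hG := abs_Gamma_div_Gamma_sub_rpow_le (a := α / 2)
    ⟨by linarith [hα'.1], by linarith [hα'.2]⟩ hn
  rw [mul_div_cancel₀ _ two_ne_zero] at hG
  have hp : 0 ≤ (n : ℝ) ^ (α - 3) := by positivity
  rw [Lsymb_eq hα' hα1, ← hK, add_sub_cancel_left, ← mul_sub, abs_mul]
  calc _ ≤ |K| * (2 * (n : ℝ) ^ (α - 3)) := by gcongr
    _ ≤ _ := by linarith
end
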